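/- arXiv:1901.09996 — 3 statements merged into one kernel-verified Lean document; each statement's English description precedes it below -/
import Mathlib

section
/- Let α ∈ (1,2], η ∈ (0,1], 0 ≤ λ < 2/η², let θ ∈ (0, 1/2) be fixed, and let f : [0,1] × [0,∞) → [0,∞) be continuous. Suppose the limit f⁰ = lim_{x→0⁺} max_{t∈[0,1]} f(t,x)/x exists in [0,∞] and satisfies f⁰ < Λ₂, and the limit f_∞ = lim_{x→+∞} min_{t∈[0,1]} f(t,x)/x exists in [0,∞] and satisfies f_∞ > Λ₁. Then there exists a continuous function x : [0,1] → ℝ with x(t) ≥ 0 for all t ∈ [0,1], x not identically zero, x twice differentiable on (0,1), satisfying t^(2-α)·x''(t) + f(t, x(t)) = 0 for all t ∈ (0,1), x(0) = 0, and x(1) = λ·∫₀^η x(t) dt. -/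
open Set MeasureTheory

/-- The Green's function `G(t,s)` for the conformable fractional BVP. -/
noncomputable def Gf (α t s : ℝ) : ℝ :=
  if s ≤ t then (1 - t) * s ^ (α - 1) else t * (1 - s) * s ^ (α - 2)

/-- The auxiliary kernel `H(t,s)` for the conformable fractional BVP. -/
noncomputable def Hf (α t s : ℝ) : ℝ :=
  if s ≤ t then (2 * t - t ^ 2 - s) * s ^ (α - 1) else t ^ 2 * (1 - s) * s ^ (α - 2)

/-- The full kernel `K(t,s) = G(t,s) + (λ t/(2 - λ η²)) H(η,s)`. -/
noncomputable def Kf (α η lam t s : ℝ) : ℝ :=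
  Gf α t s + lam * t / (2 - lam * η ^ 2) * Hf α η s


open Filter Topology

/-- The solution of `dx' = -g dμ` on `[0, 1]` with `x 0 = 0` and initial slope `c`. -/
noncomputable def shoot (μ : Measure ℝ) (c : ℝ) (g : ℝ → ℝ) (t : ℝ) : ℝ :=
  c * t - ∫ s in Icc (0 : ℝ) 1, max (t - s) 0 * g s ∂μ

section Shoot

variable {μ : Measure ℝ} {c : ℝ} {g : ℝ → ℝ}

theorem shoot_of_nonpos {t : ℝ} (ht : t ≤ 0) : shoot μ c g t = c * t := by
  have : ∫ s in Icc (0 : ℝ) 1, max (t - s) 0 * g s ∂μ = 0 := by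
    rw [setIntegral_congr_fun (g := fun _ => 0) measurableSet_Icc]
    · simp
    · intro s hs
      have : max (t - s) 0 = 0 := max_eq_right (by linarith [hs.1])
      simp [this]
  simp [shoot, this]

theorem shoot_le (hg0 : ∀ s ∈ Icc (0 : ℝ) 1, 0 ≤ g s) (t : ℝ) : shoot μ c g t ≤ c * t := by
  have : 0 ≤ ∫ s in Icc (0 : ℝ) 1, max (t - s) 0 * g s ∂μ :=
    setIntegral_nonneg measurableSet_Icc fun s hs => mul_nonneg (le_max_right _ _) (hg0 s hs)
  simp only [shoot]; linarith

variable [IsFiniteMeasure μ]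

theorem integrableOn_max_sub_mul (hg : Continuous g) (t : ℝ) :
    IntegrableOn (fun s => max (t - s) 0 * g s) (Icc 0 1) μ :=
  Continuous.integrableOn_Icc (by fun_prop)

theorem concaveOn_shoot (hg : Continuous g) (hg0 : ∀ s ∈ Icc (0 : ℝ) 1, 0 ≤ g s) :
    ConcaveOn ℝ univ (shoot μ c g) := by
  refine ⟨convex_univ, fun a _ b _ p q hp hq hpq => ?_⟩
  have ha := integrableOn_max_sub_mul (μ := μ) hg a
  have hb := integrableOn_max_sub_mul (μ := μ) hg b
  have key : ∫ s in Icc (0 : ℝ) 1, max ((p * a + q * b) - s) 0 * g s ∂μ ≤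
      p * (∫ s in Icc (0 : ℝ) 1, max (a - s) 0 * g s ∂μ) +
      q * ∫ s in Icc (0 : ℝ) 1, max (b - s) 0 * g s ∂μ := by
    rw [← integral_const_mul, ← integral_const_mul,
      ← integral_add (ha.const_mul p) (hb.const_mul q)]
    refine setIntegral_mono_on (integrableOn_max_sub_mul hg _)
      ((ha.const_mul p).add (hb.const_mul q)) measurableSet_Icc fun s hs => ?_
    have h1 : max ((p * a + q * b) - s) 0 ≤ p * max (a - s) 0 + q * max (b - s) 0 := by
      apply max_le
      · have e : p * a + q * b - s = p * (a - s) + q * (b - s) := by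
          linear_combination s * hpq
        rw [e]
        gcongr <;> exact le_max_left _ _
      · have := le_max_right (a - s) 0
        have := le_max_right (b - s) 0
        positivity
    calc _ ≤ (p * max (a - s) 0 + q * max (b - s) 0) * g s :=
          mul_le_mul_of_nonneg_right h1 (hg0 s hs)
      _ = _ := by ring
  simp only [shoot, smul_eq_mul]
  linarith

theorem abs_shoot_sub_le {B : ℝ} (hg : Continuous g)
    (hgB : ∀ s ∈ Icc (0 : ℝ) 1, |g s| ≤ B) (t t' : ℝ) :
    |shoot μ c g t - shoot μ c g t'| ≤ (|c| + B * μ.real (Icc 0 1)) * |t - t'| := by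
  have h : |∫ s in Icc (0 : ℝ) 1, (max (t - s) 0 * g s - max (t' - s) 0 * g s) ∂μ| ≤
      (|t - t'| * B) * μ.real (Icc 0 1) := by
    rw [← Real.norm_eq_abs]
    refine norm_setIntegral_le_of_norm_le_const (measure_lt_top μ _) fun s hs => ?_
    rw [← sub_mul, Real.norm_eq_abs, abs_mul]
    have h1 : |max (t - s) 0 - max (t' - s) 0| ≤ |t - t'| := by
      have := abs_max_sub_max_le_abs (t - s) (t' - s) 0
      simpa using this
    exact mul_le_mul h1 (hgB s hs) (abs_nonneg _) (abs_nonneg _)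
  rw [integral_sub (integrableOn_max_sub_mul hg _) (integrableOn_max_sub_mul hg _)] at h
  have e : shoot μ c g t - shoot μ c g t' = c * (t - t') -
    ((∫ s in Icc (0 : ℝ) 1, max (t - s) 0 * g s ∂μ) -
      ∫ s in Icc (0 : ℝ) 1, max (t' - s) 0 * g s ∂μ) := by simp only [shoot]; ring
  rw [e]
  refine (abs_sub _ _).trans ?_
  rw [abs_mul]
  linarith

theorem integral_max_sub {η s : ℝ} (hη : 0 ≤ η) (hs : 0 ≤ s) :
    ∫ t in (0 : ℝ)..η, max (t - s) 0 = max (η - s) 0 ^ 2 / 2 := by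
  have hi : ∀ a b : ℝ, IntervalIntegrable (fun t : ℝ => max (t - s) 0) volume a b :=
    fun a b => Continuous.intervalIntegrable (by fun_prop) a b
  have hz : ∀ b, 0 ≤ b → b ≤ s → ∫ t in (0 : ℝ)..b, max (t - s) 0 = 0 := by
    intro b hb hbs
    rw [intervalIntegral.integral_congr (g := fun _ => (0 : ℝ))]
    · simp
    · intro t ht
      rw [uIcc_of_le hb] at ht
      exact max_eq_right (by linarith [ht.2])
  rcases le_total η s with h | h
  · rw [hz η hη h, max_eq_right (by linarith)]; simp
  · rw [← intervalIntegral.integral_add_adjacent_intervals (hi 0 s) (hi s η), hz s hs le_rfl,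
      max_eq_left (by linarith), intervalIntegral.integral_congr (g := fun t => t - s)]
    · simp
      ring
    · intro t ht
      rw [uIcc_of_le h] at ht
      exact max_eq_left (by linarith [ht.1])

theorem continuous_uncurry_shoot {G : ℝ → ℝ → ℝ} (hG : Continuous (Function.uncurry G)) :
    Continuous (fun p : ℝ × ℝ => shoot μ p.1 (G p.1) p.2) := by
  unfold shoot
  refine Continuous.sub (by fun_prop) ?_
  refine continuous_parametric_integral_of_continuous
    (f := fun p : ℝ × ℝ => fun s => max (p.2 - s) 0 * G p.1 s) ?_ isCompact_Icc
  have : Continuous fun q : (ℝ × ℝ) × ℝ => G q.1.1 q.2 :=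
    hG.comp (f := fun q : (ℝ × ℝ) × ℝ => (q.1.1, q.2)) (by fun_prop)
  simp only [Function.uncurry_def]
  fun_prop

theorem continuous_shoot (hg : Continuous g) : Continuous (shoot μ c g) :=
  (continuous_uncurry_shoot (μ := μ) (G := fun _ => g)
    (by simp only [Function.uncurry_def]; fun_prop)).comp (f := fun t => (c, t)) (by fun_prop)

theorem integral_shoot {η : ℝ} (hη : 0 ≤ η) (hg : Continuous g) :
    ∫ t in (0 : ℝ)..η, shoot μ c g t =
      c * η ^ 2 / 2 - ∫ s in Icc (0 : ℝ) 1, max (η - s) 0 ^ 2 / 2 * g s ∂μ := by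
  have hc : Continuous fun t => ∫ s in Icc (0 : ℝ) 1, max (t - s) 0 * g s ∂μ :=
    (continuous_shoot (μ := μ) (c := 0) hg).neg.congr fun t => by simp [shoot]
  have hsw : ∫ t in (0 : ℝ)..η, ∫ s in Icc (0 : ℝ) 1, max (t - s) 0 * g s ∂μ =
      ∫ s in Icc (0 : ℝ) 1, (∫ t in (0 : ℝ)..η, max (t - s) 0 * g s) ∂μ := by
    rw [intervalIntegral_integral_swap]
    rw [Measure.prod_restrict]
    refine IntegrableOn.mono_set (t := Icc 0 η ×ˢ Icc 0 1) ?_ ?_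
    · refine ContinuousOn.integrableOn_compact (isCompact_Icc.prod isCompact_Icc) ?_
      simp only [Function.uncurry_def]
      fun_prop
    · rw [uIoc_of_le hη]
      exact prod_mono Ioc_subset_Icc_self le_rfl
  have hl : ∫ t in (0 : ℝ)..η, c * t = c * η ^ 2 / 2 := by
    rw [intervalIntegral.integral_const_mul, integral_id]
    ring
  unfold shoot
  rw [intervalIntegral.integral_sub (Continuous.intervalIntegrable (by fun_prop) _ _)
    (hc.intervalIntegrable _ _), hsw, hl]
  congr 1
  refine setIntegral_congr_fun measurableSet_Icc fun s hs => ?_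
  rw [intervalIntegral.integral_mul_const, integral_max_sub hη hs.1]

end Shoot

section Delay

variable {μ : Measure ℝ} [IsFiniteMeasure μ] {F : ℝ → ℝ → ℝ}

theorem exists_delayed_solution (hF : Continuous (Function.uncurry F)) {δ : ℝ} (hδ : 0 < δ) :
    ∃ X : ℝ → ℝ → ℝ, Continuous (Function.uncurry X) ∧
      ∀ c, ∀ t ≤ 1, X c t = shoot μ c (fun s => F s (X c (s - δ))) t := by
  have step : ∀ m : ℕ, ∃ X : ℝ → ℝ → ℝ, Continuous (Function.uncurry X) ∧
      ∀ c, ∀ t ≤ m * δ, X c t = shoot μ c (fun s => F s (X c (s - δ))) t := by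
    intro m
    induction m with
    | zero =>
      refine ⟨fun c t => c * t, by simp only [Function.uncurry_def]; fun_prop, fun c t ht => ?_⟩
      exact (shoot_of_nonpos (by simpa using ht)).symm
    | succ m ih =>
      obtain ⟨X, hX, hXeq⟩ := ih
      have hG : Continuous (Function.uncurry fun c s => F s (X c (s - δ))) := by
        simp only [Function.uncurry_def] at hF hX ⊢
        exact hF.comp (f := fun p : ℝ × ℝ => (p.2, X p.1 (p.2 - δ))) (continuous_snd.prodMk
          (hX.comp (f := fun p : ℝ × ℝ => (p.1, p.2 - δ)) (by fun_prop)))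
      refine ⟨fun c t => shoot μ c (fun s => F s (X c (s - δ))) t,
        continuous_uncurry_shoot hG, fun c t ht => ?_⟩
      simp only [shoot]
      congr 1
      refine setIntegral_congr_fun measurableSet_Icc fun s hs => ?_
      rcases le_total t s with h | h
      · simp [max_eq_right (show t - s ≤ 0 by linarith)]
      · have := hXeq c (s - δ) (by push_cast at ht; linarith)
        simp only [shoot] at this
        simp only [← this]
  obtain ⟨m, hm⟩ := exists_nat_ge (1 / δ)
  obtain ⟨X, hX, hXeq⟩ := step m
  exact ⟨X, hX, fun c t ht => hXeq c t (ht.trans ((div_le_iff₀ hδ).1 hm))⟩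

/-- For small initial slopes the endpoint lies above the nonlocal boundary value. -/
theorem boundary_lt_of_slope_small {η lam c δ ρ r : ℝ} {x : ℝ → ℝ}
    (hη : 0 ≤ η) (hη1 : η ≤ 1) (hlam : 0 ≤ lam)
    (hF : Continuous (Function.uncurry F))
    (hF0 : ∀ s ∈ Icc (0 : ℝ) 1, ∀ u, 0 ≤ F s u)
    (hFneg : ∀ s u, u ≤ 0 → F s u = F s 0)
    (hρ : 0 ≤ ρ)
    (hsmall : ∀ s ∈ Icc (0 : ℝ) 1, ∀ u ∈ Icc 0 r, F s u ≤ ρ * u)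
    (hρint : ρ * ∫ s in Icc (0 : ℝ) 1, (1 - s) * s ∂μ < 1 - lam * η ^ 2 / 2)
    (hδ : 0 ≤ δ) (hc : 0 < c) (hcr : c ≤ r) (hx : Continuous x)
    (hxeq : ∀ t ≤ 1, x t = shoot μ c (fun s => F s (x (s - δ))) t) :
    lam * ∫ t in (0 : ℝ)..η, x t < x 1 := by
  have hxle : ∀ t ≤ 1, x t ≤ c * t := fun t ht => by
    rw [hxeq t ht]
    exact shoot_le (fun s hs => hF0 s hs _) t
  have hg : Continuous fun s => F s (x (s - δ)) := by
    simp only [Function.uncurry_def] at hF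
    exact hF.comp (f := fun s : ℝ => (s, x (s - δ))) (by fun_prop)
  have hgle : ∀ s ∈ Icc (0 : ℝ) 1, F s (x (s - δ)) ≤ ρ * (c * s) := by
    intro s hs
    have h0 : 0 ≤ c * s := mul_nonneg hc.le hs.1
    rcases le_total (x (s - δ)) 0 with h | h
    · rw [hFneg s _ h]
      have := hsmall s hs 0 ⟨le_rfl, hc.le.trans hcr⟩
      nlinarith [mul_nonneg hρ h0]
    · have h1 : x (s - δ) ≤ c * s := (hxle _ (by linarith [hs.2])).trans (by gcongr; linarith)
      refine (hsmall s hs _ ⟨h, h1.trans ?_⟩).trans (by gcongr)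
      nlinarith [hs.2]
  have hint : ∫ s in Icc (0 : ℝ) 1, max (1 - s) 0 * F s (x (s - δ)) ∂μ ≤
      c * (ρ * ∫ s in Icc (0 : ℝ) 1, (1 - s) * s ∂μ) := by
    rw [← integral_const_mul, ← integral_const_mul]
    refine setIntegral_mono_on (integrableOn_max_sub_mul hg 1)
      (Continuous.integrableOn_Icc (by fun_prop)) measurableSet_Icc fun s hs => ?_
    have h1 : 0 ≤ 1 - s := by linarith [hs.2]
    rw [max_eq_left h1]
    calc _ ≤ (1 - s) * (ρ * (c * s)) := mul_le_mul_of_nonneg_left (hgle s hs) h1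
      _ = _ := by ring
  have hxint : ∫ t in (0 : ℝ)..η, x t ≤ c * η ^ 2 / 2 := by
    calc _ ≤ ∫ t in (0 : ℝ)..η, c * t := intervalIntegral.integral_mono_on hη
          (hx.intervalIntegrable _ _) (Continuous.intervalIntegrable (by fun_prop) _ _)
          fun t ht => hxle t (ht.2.trans hη1)
      _ = _ := by
        rw [intervalIntegral.integral_const_mul, integral_id]
        ring
  have h1 := hxeq 1 le_rfl
  simp only [shoot] at h1
  have h2 := mul_lt_mul_of_pos_left hρint hc
  have h3 := mul_le_mul_of_nonneg_left hxint hlam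
  nlinarith

theorem ConcaveOn.min_mul_le {y : ℝ → ℝ} (hy : ConcaveOn ℝ univ y) (h0 : 0 ≤ y 0) (h1 : 0 ≤ y 1)
    {t p : ℝ} (ht : t ∈ Icc (0 : ℝ) 1) (hp : p ∈ Icc (0 : ℝ) 1) (hyp : 0 ≤ y p) :
    min t (1 - t) * y p ≤ y t := by
  obtain ⟨ht0, ht1⟩ := ht
  obtain ⟨hp0, hp1⟩ := hp
  rcases le_total t p with h | h
  · rcases hp0.eq_or_lt with rfl | hp0
    · have : t = 0 := le_antisymm h ht0
      subst this
      simpa using h0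
    · have := hy.2 (mem_univ 0) (mem_univ p)
        (show 0 ≤ 1 - t / p by rw [sub_nonneg, div_le_one hp0]; exact h)
        (show 0 ≤ t / p by positivity) (by ring)
      simp only [smul_eq_mul, mul_zero, zero_add, div_mul_cancel₀ _ hp0.ne'] at this
      have h2 : t ≤ t / p := by rw [le_div_iff₀ hp0]; nlinarith
      have h3 : 0 ≤ 1 - t / p := by rw [sub_nonneg, div_le_one hp0]; exact h
      have h4 := mul_le_mul_of_nonneg_right ((min_le_left t (1 - t)).trans h2) hyp
      nlinarith [mul_nonneg h3 h0]
  · rcases hp1.eq_or_lt with rfl | hp1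
    · have : t = 1 := le_antisymm ht1 h
      subst this
      simpa using h1
    · have hq : 0 < 1 - p := by linarith
      have hs : (1 - t) / (1 - p) ≤ 1 := by rw [div_le_one hq]; linarith
      have h2 : 1 - t ≤ (1 - t) / (1 - p) := by rw [le_div_iff₀ hq]; nlinarith
      have := hy.2 (mem_univ 1) (mem_univ p)
        (show 0 ≤ 1 - (1 - t) / (1 - p) by linarith)
        (show 0 ≤ (1 - t) / (1 - p) from div_nonneg (by linarith) hq.le) (by ring)
      have e : (1 - (1 - t) / (1 - p)) • (1 : ℝ) + ((1 - t) / (1 - p)) • p = t := by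
        simp only [smul_eq_mul]
        field_simp
        ring
      rw [e] at this
      simp only [smul_eq_mul] at this
      have h4 := mul_le_mul_of_nonneg_right ((min_le_right t (1 - t)).trans h2) hyp
      nlinarith [mul_nonneg (show 0 ≤ 1 - (1 - t) / (1 - p) by linarith) h1]

theorem ConcaveOn.nonneg_of_boundary {η lam : ℝ} {y : ℝ → ℝ} (hy : ConcaveOn ℝ univ y)
    (hyc : Continuous y) (h0 : y 0 = 0) (hη : 0 ≤ η) (hη1 : η ≤ 1) (hlam : 0 ≤ lam)
    (hD : 0 < 1 - lam * η ^ 2 / 2) (hb : lam * ∫ t in (0 : ℝ)..η, y t ≤ y 1) :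
    ∀ t ∈ Icc (0 : ℝ) 1, 0 ≤ y t := by
  have hlin : ∀ t ∈ Icc (0 : ℝ) 1, y 1 * t ≤ y t := by
    intro t ht
    have := hy.2 (mem_univ 0) (mem_univ 1)
      (show 0 ≤ 1 - t by linarith [ht.2]) ht.1 (by ring)
    simp only [smul_eq_mul, mul_zero, zero_add, mul_one, h0] at this
    linarith
  have hint : y 1 * η ^ 2 / 2 ≤ ∫ t in (0 : ℝ)..η, y t := by
    calc _ = ∫ t in (0 : ℝ)..η, y 1 * t := by
          rw [intervalIntegral.integral_const_mul, integral_id]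
          ring
      _ ≤ _ := intervalIntegral.integral_mono_on hη
          (Continuous.intervalIntegrable (by fun_prop) _ _) (hyc.intervalIntegrable _ _)
          fun t ht => hlin t ⟨ht.1, ht.2.trans hη1⟩
  have hy1 : 0 ≤ y 1 := by
    have := mul_le_mul_of_nonneg_left hint hlam
    by_contra! hneg
    nlinarith [mul_pos_of_neg_of_neg hneg (show -(1 - lam * η ^ 2 / 2) < 0 by linarith)]
  exact fun t ht => (mul_nonneg hy1 ht.1).trans (hlin t ht)

theorem sq_mul_one_sub_sub_max_sq_nonneg {η s : ℝ} (hη : 0 ≤ η) (hη1 : η ≤ 1)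
    (hs : s ∈ Icc (0 : ℝ) 1) : 0 ≤ η ^ 2 * (1 - s) - max (η - s) 0 ^ 2 := by
  rcases le_total η s with h | h
  · rw [max_eq_right (by linarith)]
    nlinarith [mul_nonneg (sq_nonneg η) (show 0 ≤ 1 - s by linarith [hs.2])]
  · rw [max_eq_left (by linarith)]
    have : 0 ≤ s * (2 * η - η ^ 2 - s) := mul_nonneg hs.1 (by nlinarith)
    nlinarith

/-- For large initial slopes the endpoint lies below the nonlocal boundary value. -/
theorem lt_boundary_of_slope_large {η lam θ c δ M R B : ℝ} {x : ℝ → ℝ}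
    (hη : 0 ≤ η) (hη1 : η ≤ 1) (hlam : 0 ≤ lam) (hD : 0 < 1 - lam * η ^ 2 / 2)
    (hθ : 0 < θ)
    (hF : Continuous (Function.uncurry F))
    (hF0 : ∀ s ∈ Icc (0 : ℝ) 1, ∀ u, 0 ≤ F s u)
    (hM : 0 ≤ M) (hR : 0 ≤ R)
    (hlarge : ∀ s ∈ Icc (0 : ℝ) 1, ∀ u, R ≤ u → M * u ≤ F s u)
    (hB : ∀ s ∈ Icc (0 : ℝ) 1, ∀ u ≤ 2 * R / θ, F s u ≤ B)
    (hMint : 1 - lam * η ^ 2 / 2 < M * (θ / 4) * ∫ s in Icc θ (1 - θ),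
      ((1 - lam * η ^ 2 / 2) * (s * (1 - s)) +
        lam / 2 * (η ^ 2 * (1 - s) - max (η - s) 0 ^ 2)) ∂μ)
    (hδ : 0 ≤ δ) (hδθ : δ ≤ θ / 2) (hc : 2 * R / θ + B * μ.real (Icc 0 1) < c)
    (hx : Continuous x)
    (hxeq : ∀ t ≤ 1, x t = shoot μ c (fun s => F s (x (s - δ))) t) :
    x 1 < lam * ∫ t in (0 : ℝ)..η, x t := by
  by_contra! hcon
  set g : ℝ → ℝ := fun s => F s (x (s - δ)) with hgdef
  set D := 1 - lam * η ^ 2 / 2 with hDdef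
  set k : ℝ → ℝ := fun s => D * (s * (1 - s)) +
    lam / 2 * (η ^ 2 * (1 - s) - max (η - s) 0 ^ 2) with hk
  have hg : Continuous g := by
    simp only [Function.uncurry_def] at hF
    exact hF.comp (f := fun s : ℝ => (s, x (s - δ))) (by fun_prop)
  have hg0 : ∀ s ∈ Icc (0 : ℝ) 1, 0 ≤ g s := fun s hs => hF0 s hs _
  have hkc : Continuous k := by fun_prop
  have hk0 : ∀ s ∈ Icc (0 : ℝ) 1, 0 ≤ k s := fun s hs => by
    have := mul_nonneg hs.1 (show 0 ≤ 1 - s by linarith [hs.2])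
    have := sq_mul_one_sub_sub_max_sq_nonneg hη hη1 hs
    simp only [hk]
    positivity
  set y := shoot μ c g with hy
  have hyc : Continuous y := continuous_shoot hg
  have hconc : ConcaveOn ℝ univ y := concaveOn_shoot hg hg0
  have hy0 : y 0 = 0 := by simp [hy, shoot_of_nonpos le_rfl]
  have hxy : ∫ t in (0 : ℝ)..η, x t = ∫ t in (0 : ℝ)..η, y t := by
    refine intervalIntegral.integral_congr fun t ht => ?_
    rw [uIcc_of_le hη] at ht
    exact hxeq t (ht.2.trans hη1)
  rw [hxy, hxeq 1 le_rfl] at hcon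
  have hynn := hconc.nonneg_of_boundary hyc hy0 hη hη1 hlam hD hcon
  have hy1 := hynn 1 (by simp)
  obtain ⟨p, hp, hmax⟩ := isCompact_Icc.exists_isMaxOn (nonempty_Icc.2 (zero_le_one' ℝ))
    hyc.continuousOn
  have hmax' : ∀ t ∈ Icc (0 : ℝ) 1, y t ≤ y p := fun t ht => hmax ht
  have hB0 : 0 ≤ B := (hF0 0 (by simp) 0).trans (hB 0 (by simp) 0 (by positivity))
  have hbig : 2 * R / θ < y p := by
    by_contra! hle
    have hgB : ∫ s in Icc (0 : ℝ) 1, max (1 - s) 0 * g s ∂μ ≤ B * μ.real (Icc 0 1) := by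
      calc _ ≤ ∫ s in Icc (0 : ℝ) 1, B ∂μ := by
            refine setIntegral_mono_on (integrableOn_max_sub_mul hg 1)
              (Continuous.integrableOn_Icc (by fun_prop)) measurableSet_Icc fun s hs => ?_
            have hgs : g s ≤ B := by
              refine hB s hs _ ?_
              rw [hxeq _ (by linarith [hs.2])]
              rcases le_total (s - δ) 0 with h | h
              · rw [hy, shoot_of_nonpos h]
                have : 0 < c := lt_of_le_of_lt (by positivity) hc
                exact (mul_nonpos_of_nonneg_of_nonpos this.le h).trans (by positivity)
              · exact (hmax' _ ⟨h, by linarith [hs.2]⟩).trans hle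
            calc _ ≤ 1 * g s := mul_le_mul_of_nonneg_right
                  (max_le (by linarith [hs.1]) zero_le_one) (hg0 s hs)
              _ ≤ B := by linarith
        _ = _ := by simp [mul_comm]
    have h1 := hmax' 1 (by simp)
    simp only [hy, shoot] at h1 hle
    linarith
  have hN : 0 < y p := lt_of_le_of_lt (by positivity) hbig
  have hglarge : ∀ s ∈ Icc θ (1 - θ), M * (θ / 2 * y p) ≤ g s := by
    intro s hs
    have hsd : s - δ ∈ Icc (0 : ℝ) 1 := ⟨by linarith [hs.1], by linarith [hs.2]⟩
    have h1 : θ / 2 * y p ≤ x (s - δ) := by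
      rw [hxeq _ hsd.2]
      refine le_trans ?_ (hconc.min_mul_le hy0.ge hy1 hsd hp hN.le)
      gcongr
      exact le_min (by linarith [hs.1]) (by linarith [hs.2])
    have h2 : R ≤ x (s - δ) := by
      rw [div_lt_iff₀ hθ] at hbig
      linarith
    exact (mul_le_mul_of_nonneg_left h1 hM).trans
      (hlarge s ⟨by linarith [hs.1], by linarith [hs.2]⟩ _ h2)
  have hkg : IntegrableOn (fun s => k s * g s) (Icc 0 1) μ :=
    Continuous.integrableOn_Icc (by fun_prop)
  have hsub : Icc θ (1 - θ) ⊆ Icc (0 : ℝ) 1 := Icc_subset_Icc hθ.le (by linarith)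
  have hlow : M * (θ / 2 * y p) * ∫ s in Icc θ (1 - θ), k s ∂μ ≤
      ∫ s in Icc (0 : ℝ) 1, k s * g s ∂μ := by
    calc _ ≤ ∫ s in Icc θ (1 - θ), k s * g s ∂μ := by
          rw [← integral_const_mul]
          refine setIntegral_mono_on (Continuous.integrableOn_Icc (by fun_prop))
            (hkg.mono_set hsub) measurableSet_Icc fun s hs => ?_
          rw [mul_comm (k s)]
          exact mul_le_mul_of_nonneg_right (hglarge s hs) (hk0 s (hsub hs))
      _ ≤ _ := by
          refine setIntegral_mono_set hkg ?_ (Filter.Eventually.of_forall hsub)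
          filter_upwards [ae_restrict_mem measurableSet_Icc] with s hs
          exact mul_nonneg (hk0 s hs) (hg0 s hs)
  have hup : (∫ s in Icc (0 : ℝ) 1, k s * g s ∂μ) / 2 ≤ D * y (1 / 2) := by
    have hA := integrableOn_max_sub_mul (μ := μ) hg 1
    have hA2 := integrableOn_max_sub_mul (μ := μ) hg (1 / 2)
    have hA3 : IntegrableOn (fun s => max (η - s) 0 ^ 2 / 2 * g s) (Icc 0 1) μ :=
      Continuous.integrableOn_Icc (by fun_prop)
    have hA13 : IntegrableOn (fun s => (1 / 2) * (max (1 - s) 0 * g s) -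
        lam / 2 * (max (η - s) 0 ^ 2 / 2 * g s)) (Icc 0 1) μ :=
      (hA.const_mul _).sub (hA3.const_mul _)
    have hmono : ∫ s in Icc (0 : ℝ) 1, k s * g s / 2 ∂μ ≤
        ∫ s in Icc (0 : ℝ) 1, ((1 / 2) * (max (1 - s) 0 * g s) -
          lam / 2 * (max (η - s) 0 ^ 2 / 2 * g s) - D * (max (1 / 2 - s) 0 * g s)) ∂μ := by
      refine setIntegral_mono_on (Continuous.integrableOn_Icc (by fun_prop))
        (hA13.sub (hA2.const_mul _)) measurableSet_Icc fun s hs => ?_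
      have hker : k s / 2 ≤ (1 / 2) * max (1 - s) 0 - lam / 2 * (max (η - s) 0 ^ 2 / 2) -
          D * max (1 / 2 - s) 0 := by
        rw [max_eq_left (show 0 ≤ 1 - s by linarith [hs.2])]
        have : max (1 / 2 - s) 0 ≤ (1 - s) / 2 - s * (1 - s) / 2 := by
          apply max_le <;> nlinarith [sq_nonneg (1 - s), sq_nonneg s, hs.1, hs.2]
        have h2 := mul_le_mul_of_nonneg_left this hD.le
        have : k s / 2 = (1 / 2) * (1 - s) - lam / 2 * (max (η - s) 0 ^ 2 / 2) -
            D * ((1 - s) / 2 - s * (1 - s) / 2) := by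
          simp only [hk, hDdef]
          ring
        linarith
      have := mul_le_mul_of_nonneg_right hker (hg0 s hs)
      linarith
    rw [integral_div, integral_sub hA13 (hA2.const_mul _),
      integral_sub (hA.const_mul _) (hA3.const_mul _), integral_const_mul, integral_const_mul,
      integral_const_mul] at hmono
    rw [hy, integral_shoot hη hg] at hcon
    simp only [hy, shoot] at hcon ⊢
    set I1 := ∫ s in Icc (0 : ℝ) 1, max (1 - s) 0 * g s ∂μ
    set I2 := ∫ s in Icc (0 : ℝ) 1, max (1 / 2 - s) 0 * g s ∂μ
    set I3 := ∫ s in Icc (0 : ℝ) 1, max (η - s) 0 ^ 2 / 2 * g s ∂μ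
    have hexp : D * (c * (1 / 2) - I2) = c / 2 - lam * (c * η ^ 2 / 2) / 2 - D * I2 := by
      simp only [hDdef]
      ring
    linarith
  have hyp : D * y (1 / 2) ≤ D * y p :=
    mul_le_mul_of_nonneg_left (hmax' _ (by norm_num)) hD.le
  have hfin := mul_lt_mul_of_pos_right hMint hN
  nlinarith

end Delay

section Existence

theorem exists_subseq_tendsto_of_lipschitz {x : ℕ → ℝ → ℝ} {K A : ℝ} (hK : 0 ≤ K)
    (hx : ∀ n, ∀ s ∈ Icc (0 : ℝ) 1, ∀ t ∈ Icc (0 : ℝ) 1, |x n s - x n t| ≤ K * |s - t|)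
    (hA : ∀ n, ∀ t ∈ Icc (0 : ℝ) 1, |x n t| ≤ A) :
    ∃ φ : ℕ → ℕ, StrictMono φ ∧ ∃ y : ℝ → ℝ, Continuous y ∧
      ∀ t ∈ Icc (0 : ℝ) 1, Tendsto (fun n => x (φ n) t) atTop (𝓝 (y t)) := by
  have hlip : ∀ n, LipschitzWith K.toNNReal fun t : Icc (0 : ℝ) 1 => x n t := fun n =>
    LipschitzWith.of_dist_le_mul fun s t => by
      simpa [Real.dist_eq, Subtype.dist_eq, hK] using hx n s s.2 t t.2
  let f : ℕ → BoundedContinuousFunction (Icc (0 : ℝ) 1) ℝ := fun n =>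
    BoundedContinuousFunction.mkOfCompact ⟨fun t : Icc (0 : ℝ) 1 => x n t, (hlip n).continuous⟩
  have hcomp : IsCompact (closure (range f)) := by
    refine BoundedContinuousFunction.arzela_ascoli (Icc (-A) A) isCompact_Icc _ ?_ ?_
    · rintro _ t ⟨n, rfl⟩
      exact abs_le.1 (hA n t t.2)
    · refine LipschitzWith.uniformEquicontinuous _ K.toNNReal ?_ |>.equicontinuous
      rintro ⟨_, n, rfl⟩
      exact hlip n
  obtain ⟨g, -, φ, hφ, hg⟩ := hcomp.tendsto_subseq fun n => subset_closure (mem_range_self n)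
  refine ⟨φ, hφ, IccExtend zero_le_one g, g.continuous.Icc_extend', fun t ht => ?_⟩
  rw [IccExtend_of_mem _ _ ht]
  exact ((continuous_eval_const (⟨t, ht⟩ : Icc (0 : ℝ) 1)).tendsto g).comp hg

variable {μ : Measure ℝ} [IsFiniteMeasure μ] {F : ℝ → ℝ → ℝ}

theorem exists_shoot_solution {η lam θ ρ r M R : ℝ}
    (hη : 0 ≤ η) (hη1 : η ≤ 1) (hlam : 0 ≤ lam) (hD : 0 < 1 - lam * η ^ 2 / 2) (hθ : 0 < θ)
    (hF : Continuous (Function.uncurry F))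
    (hF0 : ∀ s ∈ Icc (0 : ℝ) 1, ∀ u, 0 ≤ F s u)
    (hFneg : ∀ s u, u ≤ 0 → F s u = F s 0)
    (hFB : ∀ A, ∃ B, ∀ s ∈ Icc (0 : ℝ) 1, ∀ u ≤ A, F s u ≤ B)
    (hρ : 0 ≤ ρ) (hr : 0 < r)
    (hsmall : ∀ s ∈ Icc (0 : ℝ) 1, ∀ u ∈ Icc 0 r, F s u ≤ ρ * u)
    (hρint : ρ * ∫ s in Icc (0 : ℝ) 1, (1 - s) * s ∂μ < 1 - lam * η ^ 2 / 2)
    (hM : 0 ≤ M) (hR : 0 ≤ R)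
    (hlarge : ∀ s ∈ Icc (0 : ℝ) 1, ∀ u, R ≤ u → M * u ≤ F s u)
    (hMint : 1 - lam * η ^ 2 / 2 < M * (θ / 4) * ∫ s in Icc θ (1 - θ),
      ((1 - lam * η ^ 2 / 2) * (s * (1 - s)) +
        lam / 2 * (η ^ 2 * (1 - s) - max (η - s) 0 ^ 2)) ∂μ) :
    ∃ c g, 0 < c ∧ Continuous g ∧ (∀ s ∈ Icc (0 : ℝ) 1, 0 ≤ g s) ∧
      (∀ s ∈ Icc (0 : ℝ) 1, g s = F s (shoot μ c g s)) ∧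
      shoot μ c g 1 = lam * ∫ t in (0 : ℝ)..η, shoot μ c g t := by
  obtain ⟨B, hB⟩ := hFB (2 * R / θ)
  obtain ⟨C, hC⟩ : ∃ C, C = max r (2 * R / θ + B * μ.real (Icc 0 1) + 1) := ⟨_, rfl⟩
  have hrC : r ≤ C := hC ▸ le_max_left _ _
  have hCbig : 2 * R / θ + B * μ.real (Icc 0 1) < C :=
    (lt_add_one _).trans_le (hC ▸ le_max_right _ _)
  let δ : ℕ → ℝ := fun n => θ / 2 * (1 / (n + 1))
  have hδ0 : ∀ n, 0 < δ n := fun n => by positivity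
  have hδθ : ∀ n, δ n ≤ θ / 2 := fun n => by
    have : 1 / ((n : ℝ) + 1) ≤ 1 := by rw [div_le_one (by positivity)]; simp
    exact mul_le_of_le_one_right (by positivity) this
  have hδlim : Tendsto δ atTop (𝓝 0) := by
    simpa [δ] using tendsto_one_div_add_atTop_nhds_zero_nat.const_mul (θ / 2)
  have hex : ∀ n, ∃ c ∈ Icc r C, ∃ x : ℝ → ℝ, Continuous x ∧
      (∀ t ≤ 1, x t = shoot μ c (fun s => F s (x (s - δ n))) t) ∧
      x 1 = lam * ∫ t in (0 : ℝ)..η, x t := by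
    intro n
    obtain ⟨X, hX, hXeq⟩ := exists_delayed_solution (μ := μ) hF (hδ0 n)
    have hXc : ∀ c, Continuous (X c) := fun c => by
      simp only [Function.uncurry_def] at hX
      exact hX.comp (f := fun t : ℝ => (c, t)) (by fun_prop)
    have hφ : Continuous fun c => X c 1 - lam * ∫ t in (0 : ℝ)..η, X c t := by
      refine Continuous.sub ?_ (continuous_const.mul
        (intervalIntegral.continuous_parametric_intervalIntegral_of_continuous' hX 0 η))
      simp only [Function.uncurry_def] at hX
      exact hX.comp (f := fun c : ℝ => (c, (1 : ℝ))) (by fun_prop)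
    have h1 := boundary_lt_of_slope_small hη hη1 hlam hF hF0 hFneg hρ hsmall hρint (hδ0 n).le
      hr le_rfl (hXc r) (hXeq r)
    have h2 := lt_boundary_of_slope_large hη hη1 hlam hD hθ hF hF0 hM hR hlarge hB hMint
      (hδ0 n).le (hδθ n) hCbig (hXc C) (hXeq C)
    obtain ⟨c, hc, hc0⟩ := intermediate_value_Icc' hrC hφ.continuousOn
      (show (0 : ℝ) ∈ Icc _ _ from ⟨by linarith, by linarith⟩)
    exact ⟨c, hc, X c, hXc c, hXeq c, sub_eq_zero.1 hc0⟩
  choose c hc x hxc hxeq hxb using hex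
  obtain ⟨B', hB'⟩ := hFB C
  have hc0 : ∀ n, 0 < c n := fun n => hr.trans_le (hc n).1
  have hgc : ∀ n, Continuous fun s => F s (x n (s - δ n)) := fun n => by
    simp only [Function.uncurry_def] at hF
    have := hxc n
    exact hF.comp (f := fun s : ℝ => (s, x n (s - δ n))) (by fun_prop)
  have hxle : ∀ n, ∀ t ≤ 1, x n t ≤ C := fun n t ht => by
    rw [hxeq n t ht]
    refine (shoot_le (fun s hs => hF0 s hs _) t).trans ?_
    nlinarith [(hc n).2, hc0 n]
  have hgB : ∀ n, ∀ s ∈ Icc (0 : ℝ) 1, |F s (x n (s - δ n))| ≤ B' := fun n s hs => by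
    rw [abs_of_nonneg (hF0 s hs _)]
    exact hB' s hs _ (hxle n _ (by linarith [hs.2, hδ0 n]))
  have hB'0 : 0 ≤ B' := (abs_nonneg _).trans (hgB 0 0 (by simp))
  obtain ⟨K, hK⟩ : ∃ K, K = C + B' * μ.real (Icc 0 1) := ⟨_, rfl⟩
  have hK0 : 0 ≤ K := by
    have : 0 ≤ C := hr.le.trans hrC
    rw [hK]
    positivity
  have hlip : ∀ n, ∀ s ≤ 1, ∀ t ≤ 1, |x n s - x n t| ≤ K * |s - t| := fun n s hs t ht => by
    rw [hxeq n s hs, hxeq n t ht]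
    refine (abs_shoot_sub_le (hgc n) (hgB n) s t).trans ?_
    gcongr
    rw [abs_of_pos (hc0 n), hK]
    gcongr
    exact (hc n).2
  have hx0 : ∀ n, x n 0 = 0 := fun n => by
    rw [hxeq n 0 zero_le_one, shoot_of_nonpos le_rfl, mul_zero]
  have hxK : ∀ n, ∀ t ∈ Icc (0 : ℝ) 1, |x n t| ≤ K := fun n t ht => by
    have := hlip n t ht.2 0 zero_le_one
    rw [hx0, sub_zero, sub_zero, abs_of_nonneg ht.1] at this
    nlinarith [ht.2]
  obtain ⟨c', hc', φ, hφ, hcφ⟩ := isCompact_Icc.tendsto_subseq hc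
  obtain ⟨ψ, hψ, y, hyc, hy⟩ := exists_subseq_tendsto_of_lipschitz (x := fun n => x (φ n)) hK0
    (fun n s hs t ht => hlip (φ n) s hs.2 t ht.2) (fun n => hxK (φ n))
  obtain ⟨e, he⟩ : ∃ e : ℕ → ℕ, e = φ ∘ ψ := ⟨_, rfl⟩
  have het : Tendsto e atTop atTop := he ▸ (hφ.comp hψ).tendsto_atTop
  have hce : Tendsto (fun n => c (e n)) atTop (𝓝 c') := by
    rw [he]
    exact hcφ.comp hψ.tendsto_atTop
  replace hy : ∀ t ∈ Icc (0 : ℝ) 1, Tendsto (fun n => x (e n) t) atTop (𝓝 (y t)) := by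
    rw [he]
    exact hy
  have hdel : ∀ s ∈ Icc (0 : ℝ) 1,
      Tendsto (fun n => x (e n) (s - δ (e n))) atTop (𝓝 (y s)) := fun s hs => by
    have h0 : Tendsto (fun n => x (e n) (s - δ (e n)) - x (e n) s) atTop (𝓝 0) := by
      refine squeeze_zero_norm (a := fun n => K * δ (e n)) (fun n => ?_)
        (by simpa using (hδlim.comp het).const_mul K)
      have := hlip (e n) (s - δ (e n)) (by linarith [hs.2, hδ0 (e n)]) s hs.2
      rwa [show s - δ (e n) - s = -δ (e n) by ring, abs_neg, abs_of_pos (hδ0 _)] at this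
    simpa using h0.add (hy s hs)
  have hgy : Continuous fun s => F s (y s) := by
    simp only [Function.uncurry_def] at hF
    exact hF.comp (f := fun s : ℝ => (s, y s)) (by fun_prop)
  have hyeq : ∀ t ∈ Icc (0 : ℝ) 1, y t = shoot μ c' (fun s => F s (y s)) t := by
    intro t ht
    refine tendsto_nhds_unique (hy t ht) ?_
    have heq : (fun n => x (e n) t) = fun n => c (e n) * t -
        ∫ s in Icc (0 : ℝ) 1, max (t - s) 0 * F s (x (e n) (s - δ (e n))) ∂μ :=
      funext fun n => hxeq (e n) t ht.2
    rw [heq]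
    refine (hce.mul_const t).sub ?_
    refine tendsto_integral_of_dominated_convergence (fun _ => B')
      (fun n => (integrableOn_max_sub_mul (hgc (e n)) t).aestronglyMeasurable)
      (integrable_const B') (fun n => ?_) ?_
    · filter_upwards [ae_restrict_mem measurableSet_Icc] with s hs
      rw [norm_mul, Real.norm_eq_abs, Real.norm_eq_abs, abs_of_nonneg (le_max_right _ _)]
      calc _ ≤ 1 * B' := mul_le_mul (max_le (by linarith [hs.1, ht.2]) zero_le_one)
            (hgB _ s hs) (abs_nonneg _) zero_le_one
        _ = B' := one_mul _
    · filter_upwards [ae_restrict_mem measurableSet_Icc] with s hs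
      refine Tendsto.const_mul _ ?_
      simp only [Function.uncurry_def] at hF
      exact (hF.tendsto (s, y s)).comp (tendsto_const_nhds.prodMk_nhds (hdel s hs))
  refine ⟨c', fun s => F s (y s), hr.trans_le hc'.1, hgy, fun s hs => hF0 s hs _,
    fun s hs => by rw [← hyeq s hs], ?_⟩
  rw [← hyeq 1 (by simp)]
  have hint : ∫ t in (0 : ℝ)..η, shoot μ c' (fun s => F s (y s)) t = ∫ t in (0 : ℝ)..η, y t := by
    refine intervalIntegral.integral_congr fun t ht => ?_
    rw [uIcc_of_le hη] at ht
    exact (hyeq t ⟨ht.1, ht.2.trans hη1⟩).symm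
  rw [hint]
  refine tendsto_nhds_unique (hy 1 (by simp)) ?_
  simp only [hxb]
  refine Tendsto.const_mul _ ?_
  refine intervalIntegral.tendsto_integral_filter_of_dominated_convergence (fun _ => K)
    (Eventually.of_forall fun n => (hxc _).aestronglyMeasurable)
    (Eventually.of_forall fun n => Eventually.of_forall fun t ht => ?_)
    intervalIntegrable_const (Eventually.of_forall fun t ht => ?_)
  · rw [uIoc_of_le hη] at ht
    exact hxK _ t ⟨ht.1.le, ht.2.trans hη1⟩
  · rw [uIoc_of_le hη] at ht
    exact hy t ⟨ht.1.le, ht.2.trans hη1⟩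

end Existence

section PowerWeight

/-- The measure `s ^ (α - 2) ds` on `[0, 1]`. -/
noncomputable def powerMeasure (α : ℝ) : Measure ℝ :=
  (volume.restrict (Icc 0 1)).withDensity fun s => ENNReal.ofReal (s ^ (α - 2))

variable {α : ℝ}

theorem isFiniteMeasure_powerMeasure (hα : 1 < α) : IsFiniteMeasure (powerMeasure α) := by
  refine isFiniteMeasure_withDensity_ofReal ?_
  have h : IntervalIntegrable (fun s : ℝ => s ^ (α - 2)) volume 0 1 :=
    intervalIntegral.intervalIntegrable_rpow' (by linarith)
  rw [intervalIntegrable_iff_integrableOn_Icc_of_le zero_le_one] at h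
  exact h.2

theorem setIntegral_powerMeasure {a b : ℝ} (ha : 0 ≤ a) (hab : a ≤ b) (hb : b ≤ 1) (h : ℝ → ℝ) :
    ∫ s in Icc a b, h s ∂powerMeasure α = ∫ s in a..b, s ^ (α - 2) * h s := by
  have hsub : Icc a b ⊆ Icc (0 : ℝ) 1 := Icc_subset_Icc ha hb
  rw [powerMeasure, restrict_withDensity measurableSet_Icc,
    Measure.restrict_restrict measurableSet_Icc, inter_eq_left.2 hsub,
    integral_withDensity_eq_integral_toReal_smul (by fun_prop) (by simp),
    intervalIntegral.integral_of_le hab, ← integral_Icc_eq_integral_Ioc]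
  refine setIntegral_congr_fun measurableSet_Icc fun s hs => ?_
  simp [ENNReal.toReal_ofReal (Real.rpow_nonneg (ha.trans hs.1) _)]

theorem intervalIntegrable_rpow_mul {g : ℝ → ℝ} (hα : 1 < α) (hg : Continuous g) (a b : ℝ) :
    IntervalIntegrable (fun s => s ^ (α - 2) * g s) volume a b :=
  (intervalIntegral.intervalIntegrable_rpow' (by linarith)).mul_continuousOn hg.continuousOn

theorem hasDerivAt_integral_rpow_mul {g : ℝ → ℝ} {t : ℝ} (hα : 1 < α) (hg : Continuous g)
    (ht : 0 < t) :
    HasDerivAt (fun t => ∫ s in (0 : ℝ)..t, s ^ (α - 2) * g s) (t ^ (α - 2) * g t) t := by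
  refine intervalIntegral.integral_hasDerivAt_right (intervalIntegrable_rpow_mul hα hg 0 t) ?_ ?_
  · exact (Measurable.stronglyMeasurable (by fun_prop)).stronglyMeasurableAtFilter
  · exact (Real.continuousAt_rpow_const _ _ (Or.inl ht.ne')).mul hg.continuousAt

theorem shoot_powerMeasure {g : ℝ → ℝ} {c t : ℝ} (hα : 1 < α) (hg : Continuous g)
    (ht : t ∈ Icc (0 : ℝ) 1) :
    shoot (powerMeasure α) c g t = c * t - (t * (∫ s in (0 : ℝ)..t, s ^ (α - 2) * g s) -
      ∫ s in (0 : ℝ)..t, s ^ (α - 2) * (s * g s)) := by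
  have hi : ∀ a b, IntervalIntegrable (fun s => s ^ (α - 2) * (max (t - s) 0 * g s)) volume a b :=
    intervalIntegrable_rpow_mul hα (by fun_prop)
  have h1 : ∫ s in t..1, s ^ (α - 2) * (max (t - s) 0 * g s) = 0 := by
    rw [intervalIntegral.integral_congr (g := fun _ => (0 : ℝ))]
    · simp
    · intro s hs
      rw [uIcc_of_le ht.2] at hs
      simp [max_eq_right (show t - s ≤ 0 by linarith [hs.1])]
  rw [shoot, setIntegral_powerMeasure le_rfl zero_le_one le_rfl,
    ← intervalIntegral.integral_add_adjacent_intervals (hi 0 t) (hi t 1), h1, add_zero,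
    ← intervalIntegral.integral_const_mul, ← intervalIntegral.integral_sub
      ((intervalIntegrable_rpow_mul hα hg 0 t).const_mul t)
      (intervalIntegrable_rpow_mul hα (by fun_prop) 0 t)]
  congr 1
  refine intervalIntegral.integral_congr fun s hs => ?_
  rw [uIcc_of_le ht.1] at hs
  simp only [max_eq_left (show 0 ≤ t - s by linarith [hs.2])]
  ring

theorem hasDerivAt_shoot_powerMeasure {g : ℝ → ℝ} {c t : ℝ} (hα : 1 < α) (hg : Continuous g)
    (ht : t ∈ Ioo (0 : ℝ) 1) :
    HasDerivAt (shoot (powerMeasure α) c g) (c - ∫ s in (0 : ℝ)..t, s ^ (α - 2) * g s) t := by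
  have h1 := hasDerivAt_integral_rpow_mul hα hg ht.1
  have h2 := hasDerivAt_integral_rpow_mul (g := fun s => s * g s) hα (by fun_prop) ht.1
  have h3 := ((hasDerivAt_id t).const_mul c).sub (((hasDerivAt_id t).mul h1).sub h2)
  refine (h3.congr_of_eventuallyEq ?_).congr_deriv ?_
  · filter_upwards [Ioo_mem_nhds ht.1 ht.2] with s hs
    exact shoot_powerMeasure hα hg ⟨hs.1.le, hs.2.le⟩
  · simp only [id]
    ring

theorem hasDerivAt_deriv_shoot_powerMeasure {g : ℝ → ℝ} {c t : ℝ} (hα : 1 < α)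
    (hg : Continuous g) (ht : t ∈ Ioo (0 : ℝ) 1) :
    HasDerivAt (deriv (shoot (powerMeasure α) c g)) (-(t ^ (α - 2) * g t)) t := by
  refine ((hasDerivAt_integral_rpow_mul hα hg ht.1).const_sub c).congr_of_eventuallyEq ?_
  filter_upwards [Ioo_mem_nhds ht.1 ht.2] with s hs
  exact (hasDerivAt_shoot_powerMeasure hα hg hs).deriv

theorem setIntegral_one_sub_mul_powerMeasure (hα : 1 < α) :
    ∫ s in Icc (0 : ℝ) 1, (1 - s) * s ∂powerMeasure α =
      ∫ s in (0 : ℝ)..1, (1 - s) * s ^ (α - 1) := by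
  rw [setIntegral_powerMeasure le_rfl zero_le_one le_rfl]
  refine intervalIntegral.integral_congr fun s hs => ?_
  rw [uIcc_of_le zero_le_one] at hs
  have : s ^ (α - 1) = s ^ (α - 2) * s := by
    rw [← Real.rpow_add_one' hs.1 (by linarith)]
    ring_nf
  simp only [this]
  ring

theorem rpow_mul_kernel_eq {η lam s : ℝ} (hD : 2 - lam * η ^ 2 ≠ 0) (hs : 0 < s) :
    s ^ (α - 2) * ((1 - lam * η ^ 2 / 2) * (s * (1 - s)) +
        lam / 2 * (η ^ 2 * (1 - s) - max (η - s) 0 ^ 2)) =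
      (1 - lam * η ^ 2 / 2) * ((1 - s) * s ^ (α - 1) + lam / (2 - lam * η ^ 2) * Hf α η s) := by
  have h1 : s ^ (α - 1) = s ^ (α - 2) * s := by
    rw [← Real.rpow_add_one hs.ne']
    ring_nf
  have h2 : (1 - lam * η ^ 2 / 2) * (lam / (2 - lam * η ^ 2)) = lam / 2 := by
    field_simp
  have h3 : Hf α η s = s ^ (α - 2) * (η ^ 2 * (1 - s) - max (η - s) 0 ^ 2) := by
    unfold Hf
    split_ifs with h
    · rw [max_eq_left (by linarith), h1]
      ring
    · rw [max_eq_right (by linarith)]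
      ring
  rw [mul_add (1 - lam * η ^ 2 / 2), ← mul_assoc (1 - lam * η ^ 2 / 2) (lam / _), h2, h1, h3]
  ring

end PowerWeight

section Extension

variable {f : ℝ → ℝ → ℝ}

/-- The extension of a function on `[0, 1] × [0, ∞)` to the plane by clamping. -/
noncomputable def clampExtend (f : ℝ → ℝ → ℝ) (s u : ℝ) : ℝ :=
  f (max 0 (min s 1)) (max u 0)

theorem clampExtend_eq {s : ℝ} (hs : s ∈ Icc (0 : ℝ) 1) (u : ℝ) :
    clampExtend f s u = f s (max u 0) := by
  rw [clampExtend, min_eq_left hs.2, max_eq_right hs.1]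

theorem continuous_clampExtend
    (hf : ContinuousOn (fun p : ℝ × ℝ => f p.1 p.2) (Icc 0 1 ×ˢ Ici 0)) :
    Continuous (Function.uncurry (clampExtend f)) :=
  hf.comp_continuous (f := fun p : ℝ × ℝ => (max 0 (min p.1 1), max p.2 0)) (by fun_prop)
    fun p => ⟨⟨le_max_left _ _, max_le zero_le_one (min_le_right _ _)⟩, le_max_right p.2 0⟩

theorem exists_clampExtend_le
    (hf : ContinuousOn (fun p : ℝ × ℝ => f p.1 p.2) (Icc 0 1 ×ˢ Ici 0)) (A : ℝ) :
    ∃ B, ∀ s ∈ Icc (0 : ℝ) 1, ∀ u ≤ A, clampExtend f s u ≤ B := by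
  have hc := hf.mono (prod_mono_right (s := Icc (0 : ℝ) 1)
    (Icc_subset_Ici_self : Icc 0 (max A 0) ⊆ _))
  obtain ⟨B, hB⟩ := (isCompact_Icc.prod isCompact_Icc).bddAbove_image hc
  refine ⟨B, fun s hs u hu => ?_⟩
  rw [clampExtend_eq hs]
  exact hB ⟨(s, max u 0), ⟨hs, le_max_right _ _, max_le_max_right 0 hu⟩, rfl⟩

theorem isCompact_image_div
    (hf : ContinuousOn (fun p : ℝ × ℝ => f p.1 p.2) (Icc 0 1 ×ˢ Ici 0)) {u : ℝ} (hu : 0 ≤ u) :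
    IsCompact ((fun t => f t u / u) '' Icc (0 : ℝ) 1) := by
  refine isCompact_Icc.image_of_continuousOn (ContinuousOn.div_const ?_ u)
  exact hf.comp (f := fun t : ℝ => (t, u)) (by fun_prop) fun t ht => ⟨ht, hu⟩

theorem exists_le_mul_of_limsup_lt {Λ : ℝ}
    (hf : ContinuousOn (fun p : ℝ × ℝ => f p.1 p.2) (Icc 0 1 ×ˢ Ici 0))
    (hf0 : ∃ L : ENNReal,
      Tendsto (fun u : ℝ => ENNReal.ofReal (sSup ((fun t => f t u / u) '' Icc (0 : ℝ) 1)))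
        (𝓝[>] 0) (𝓝 L) ∧ L < ENNReal.ofReal Λ) :
    ∃ ρ r : ℝ, 0 ≤ ρ ∧ ρ < Λ ∧ 0 < r ∧
      ∀ s ∈ Icc (0 : ℝ) 1, ∀ u ∈ Icc 0 r, clampExtend f s u ≤ ρ * u := by
  obtain ⟨L, hL, hLΛ⟩ := hf0
  obtain ⟨q, hLq, hqΛ⟩ := exists_between hLΛ
  have hq : q ≠ ⊤ := (hqΛ.trans ENNReal.ofReal_lt_top).ne
  obtain ⟨r, hr, hsub⟩ := mem_nhdsGT_iff_exists_Ioo_subset.1 (hL.eventually_lt_const hLq)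
  have hr : 0 < r := hr
  have hpos : ∀ s ∈ Icc (0 : ℝ) 1, ∀ u ∈ Ioo 0 r, clampExtend f s u ≤ q.toReal * u := by
    intro s hs u hu
    have h1 : ENNReal.ofReal (sSup ((fun t => f t u / u) '' Icc (0 : ℝ) 1)) < q := hsub hu
    have h2 : f s u / u ≤ sSup ((fun t => f t u / u) '' Icc (0 : ℝ) 1) :=
      le_csSup (isCompact_image_div hf hu.1.le).bddAbove ⟨s, hs, rfl⟩
    have h3 : f s u / u ≤ q.toReal :=
      h2.trans ((ENNReal.ofReal_le_iff_le_toReal hq).1 h1.le)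
    rw [clampExtend_eq hs, max_eq_left hu.1.le]
    exact (div_le_iff₀ hu.1).1 h3
  refine ⟨q.toReal, r / 2, ENNReal.toReal_nonneg, ENNReal.toReal_lt_of_lt_ofReal hqΛ,
    by positivity, fun s hs u hu => ?_⟩
  rcases hu.1.eq_or_lt with rfl | hu0
  · have hc : Continuous fun u => clampExtend f s u := by
      have := continuous_clampExtend hf
      simp only [Function.uncurry_def] at this
      exact this.comp (f := fun u : ℝ => (s, u)) (by fun_prop)
    refine le_of_tendsto_of_tendsto (b := 𝓝[>] (0 : ℝ))
      ((hc.tendsto 0).mono_left nhdsWithin_le_nhds)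
      (((continuous_const_mul q.toReal).tendsto 0).mono_left nhdsWithin_le_nhds) ?_
    filter_upwards [Ioo_mem_nhdsGT hr] with v hv using hpos s hs v hv
  · exact hpos s hs u ⟨hu0, by linarith [hu.2]⟩

theorem exists_mul_le_of_lt_liminf {Λ : ℝ} (hΛ : 0 ≤ Λ)
    (hf : ContinuousOn (fun p : ℝ × ℝ => f p.1 p.2) (Icc 0 1 ×ˢ Ici 0))
    (hfinf : ∃ M : ENNReal,
      Tendsto (fun u : ℝ => ENNReal.ofReal (sInf ((fun t => f t u / u) '' Icc (0 : ℝ) 1)))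
        atTop (𝓝 M) ∧ ENNReal.ofReal Λ < M) :
    ∃ M R : ℝ, Λ < M ∧ 0 ≤ R ∧
      ∀ s ∈ Icc (0 : ℝ) 1, ∀ u, R ≤ u → M * u ≤ clampExtend f s u := by
  obtain ⟨M, hM, hΛM⟩ := hfinf
  obtain ⟨q, hΛq, hqM⟩ := exists_between hΛM
  have hq : q ≠ ⊤ := (hqM.trans_le le_top).ne
  obtain ⟨R, hR⟩ := eventually_atTop.1 (hM.eventually_const_lt hqM)
  refine ⟨q.toReal, max R 1, (ENNReal.ofReal_lt_iff_lt_toReal hΛ hq).1 hΛq, by positivity,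
    fun s hs u hu => ?_⟩
  have hu0 : 0 < u := zero_lt_one.trans_le ((le_max_right _ _).trans hu)
  have h1 := hR u ((le_max_left _ _).trans hu)
  have h2 : sInf ((fun t => f t u / u) '' Icc (0 : ℝ) 1) ≤ f s u / u :=
    csInf_le (isCompact_image_div hf hu0.le).bddBelow ⟨s, hs, rfl⟩
  have h3 : q.toReal ≤ f s u / u :=
    (ENNReal.lt_ofReal_iff_toReal_lt hq).1 h1 |>.le.trans h2
  rw [clampExtend_eq hs, max_eq_left hu0.le]
  exact (le_div_iff₀ hu0).1 h3

end Extension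

open Filter Topology in
theorem stmt12 (α η lam θ : ℝ) (hα : α ∈ Set.Ioc (1 : ℝ) 2) (hη : η ∈ Set.Ioc (0 : ℝ) 1)
    (hlam0 : 0 ≤ lam) (hlam : lam < 2 / η ^ 2) (hθ : θ ∈ Set.Ioo (0 : ℝ) (1 / 2))
    (f : ℝ → ℝ → ℝ)
    (hf : ContinuousOn (fun p : ℝ × ℝ => f p.1 p.2) (Set.Icc 0 1 ×ˢ Set.Ici 0))
    (hfnn : ∀ t ∈ Set.Icc (0 : ℝ) 1, ∀ u, 0 ≤ u → 0 ≤ f t u)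
    -- `f⁰ = lim_{u → 0⁺} max_{t ∈ [0,1]} f(t,u)/u` exists in `[0,∞]` and `f⁰ < Λ₂`
    (hf0 : ∃ L : ENNReal,
      Tendsto (fun u : ℝ => ENNReal.ofReal (sSup ((fun t => f t u / u) '' Set.Icc (0 : ℝ) 1)))
        (nhdsWithin 0 (Set.Ioi 0)) (nhds L) ∧
      L < ENNReal.ofReal
        (((1 + lam / (2 - lam * η ^ 2)) * ∫ s in (0 : ℝ)..1, (1 - s) * s ^ (α - 1))⁻¹))
    -- `f_∞ = lim_{u → ∞} min_{t ∈ [0,1]} f(t,u)/u` exists in `[0,∞]` and `f_∞ > Λ₁`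
    (hfinf : ∃ M : ENNReal,
      Tendsto (fun u : ℝ => ENNReal.ofReal (sInf ((fun t => f t u / u) '' Set.Icc (0 : ℝ) 1)))
        atTop (nhds M) ∧
      ENNReal.ofReal ((θ ^ 4 * ∫ s in θ..(1 - θ),
        ((1 - s) * s ^ (α - 1) + lam / (2 - lam * η ^ 2) * Hf α η s))⁻¹) < M) :
    ∃ x : ℝ → ℝ, ContinuousOn x (Set.Icc 0 1) ∧
      (∀ t ∈ Set.Icc (0 : ℝ) 1, 0 ≤ x t) ∧
      (∃ t ∈ Set.Icc (0 : ℝ) 1, x t ≠ 0) ∧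
      (∀ t ∈ Set.Ioo (0 : ℝ) 1, DifferentiableAt ℝ x t ∧ DifferentiableAt ℝ (deriv x) t ∧
        t ^ (2 - α) * deriv (deriv x) t + f t (x t) = 0) ∧
      x 0 = 0 ∧ x 1 = lam * ∫ t in (0 : ℝ)..η, x t := by
  obtain ⟨hη0, hη1⟩ := hη
  obtain ⟨hθ0, hθ1⟩ := hθ
  have hα1 := hα.1
  have : IsFiniteMeasure (powerMeasure α) := isFiniteMeasure_powerMeasure hα1
  have hD2 : 0 < 2 - lam * η ^ 2 := by
    rw [lt_div_iff₀ (by positivity)] at hlam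
    linarith
  have hD : 0 < 1 - lam * η ^ 2 / 2 := by linarith
  obtain ⟨ρ, r, hρ0, hρΛ, hr, hsmall⟩ := exists_le_mul_of_limsup_lt hf hf0
  have hρint : ρ * ∫ s in Icc (0 : ℝ) 1, (1 - s) * s ∂powerMeasure α < 1 - lam * η ^ 2 / 2 := by
    rw [setIntegral_one_sub_mul_powerMeasure hα1]
    set J := ∫ s in (0 : ℝ)..1, (1 - s) * s ^ (α - 1)
    have hκ : 0 ≤ lam / (2 - lam * η ^ 2) := by positivity
    have hJ : 0 < (1 + lam / (2 - lam * η ^ 2)) * J := inv_pos.1 (hρ0.trans_lt hρΛ)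
    have hJ0 : 0 < J := pos_of_mul_pos_right hJ (by positivity)
    have h1 : ρ * ((1 + lam / (2 - lam * η ^ 2)) * J) < 1 := by
      rwa [← one_div, lt_div_iff₀ hJ] at hρΛ
    have h2 : 1 ≤ (1 + lam / (2 - lam * η ^ 2)) * (1 - lam * η ^ 2 / 2) := by
      have : (1 + lam / (2 - lam * η ^ 2)) * (1 - lam * η ^ 2 / 2) =
          1 + lam * (1 - η ^ 2) / 2 := by
        field_simp
        ring
      rw [this]
      have : 0 ≤ lam * (1 - η ^ 2) := mul_nonneg hlam0 (by nlinarith)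
      linarith
    calc ρ * J ≤ ρ * J * ((1 + lam / (2 - lam * η ^ 2)) * (1 - lam * η ^ 2 / 2)) :=
          le_mul_of_one_le_right (by positivity) h2
      _ = ρ * ((1 + lam / (2 - lam * η ^ 2)) * J) * (1 - lam * η ^ 2 / 2) := by ring
      _ < 1 * (1 - lam * η ^ 2 / 2) := by gcongr
      _ = _ := one_mul _
  set I := ∫ s in θ..(1 - θ),
    ((1 - s) * s ^ (α - 1) + lam / (2 - lam * η ^ 2) * Hf α η s) with hI
  have hθθ : θ < 1 - θ := by linarith
  have hkI : ∫ s in θ..(1 - θ), s ^ (α - 2) * ((1 - lam * η ^ 2 / 2) * (s * (1 - s)) +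
      lam / 2 * (η ^ 2 * (1 - s) - max (η - s) 0 ^ 2)) = (1 - lam * η ^ 2 / 2) * I := by
    rw [hI, ← intervalIntegral.integral_const_mul]
    refine intervalIntegral.integral_congr fun s hs => ?_
    rw [uIcc_of_le hθθ.le] at hs
    exact rpow_mul_kernel_eq hD2.ne' (hθ0.trans_le hs.1)
  have hI0 : 0 < I := by
    refine pos_of_mul_pos_right (a := 1 - lam * η ^ 2 / 2) ?_ hD.le
    rw [← hkI]
    refine intervalIntegral.intervalIntegral_pos_of_pos_on
      (intervalIntegrable_rpow_mul hα1 (by fun_prop) _ _) (fun s hs => ?_) hθθ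
    have hs0 : 0 < s := hθ0.trans hs.1
    have hs1 : 0 < 1 - s := by linarith [hs.2]
    have := sq_mul_one_sub_sub_max_sq_nonneg hη0.le hη1 ⟨hs0.le, by linarith⟩
    positivity
  obtain ⟨M, R, hΛM, hR0, hlarge⟩ := exists_mul_le_of_lt_liminf (by positivity) hf hfinf
  have hM0 : 0 < M := lt_of_le_of_lt (by positivity) hΛM
  have hMint : 1 - lam * η ^ 2 / 2 < M * (θ / 4) * ∫ s in Icc θ (1 - θ),
      ((1 - lam * η ^ 2 / 2) * (s * (1 - s)) +
        lam / 2 * (η ^ 2 * (1 - s) - max (η - s) 0 ^ 2)) ∂powerMeasure α := by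
    rw [setIntegral_powerMeasure hθ0.le hθθ.le (by linarith), hkI]
    have h1 : 1 < M * (θ ^ 4 * I) := (inv_lt_iff_one_lt_mul₀ (by positivity)).1 hΛM
    have h2 : θ ^ 4 ≤ θ / 4 := by
      have : θ ^ 3 ≤ (1 / 2) ^ 3 := by gcongr
      nlinarith
    calc 1 - lam * η ^ 2 / 2 < M * (θ ^ 4 * I) * (1 - lam * η ^ 2 / 2) :=
          lt_mul_of_one_lt_left hD h1
      _ ≤ M * (θ / 4 * I) * (1 - lam * η ^ 2 / 2) := by gcongr
      _ = _ := by ring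
  obtain ⟨c, g, hc, hg, hg0, hgeq, hb⟩ := exists_shoot_solution (μ := powerMeasure α) hη0.le hη1
    hlam0 hD hθ0 (continuous_clampExtend hf)
    (fun s hs u => by
      rw [clampExtend_eq hs]
      exact hfnn s hs _ (le_max_right _ _))
    (fun s u hu => by simp [clampExtend, max_eq_right hu])
    (exists_clampExtend_le hf) hρ0 hr hsmall hρint hM0.le hR0 hlarge hMint
  have hx0 : shoot (powerMeasure α) c g 0 = 0 := by simp [shoot_of_nonpos le_rfl]
  have hxc : Continuous (shoot (powerMeasure α) c g) := continuous_shoot hg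
  have hnn := (concaveOn_shoot (c := c) hg hg0).nonneg_of_boundary hxc hx0 hη0.le hη1 hlam0 hD hb.ge
  refine ⟨shoot (powerMeasure α) c g, hxc.continuousOn, hnn, ?_, fun t ht => ?_, hx0, hb⟩
  · by_contra! hzero
    have hgz : ∀ s ∈ Icc (0 : ℝ) 1, g s = 0 := fun s hs => by
      refine le_antisymm ?_ (hg0 s hs)
      rw [hgeq s hs, hzero s hs]
      simpa using hsmall s hs 0 ⟨le_rfl, hr.le⟩
    have h1 := hzero 1 (by simp)
    rw [shoot, setIntegral_congr_fun (g := fun _ => 0) measurableSet_Icc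
      fun s hs => by simp [hgz s hs]] at h1
    simp at h1
    exact hc.ne' h1
  · have htI : t ∈ Icc (0 : ℝ) 1 := ⟨ht.1.le, ht.2.le⟩
    have hd2 := hasDerivAt_deriv_shoot_powerMeasure (c := c) hα1 hg ht
    refine ⟨(hasDerivAt_shoot_powerMeasure hα1 hg ht).differentiableAt, hd2.differentiableAt, ?_⟩
    have hgt := hgeq t htI
    rw [clampExtend_eq htI, max_eq_left (hnn t htI)] at hgt
    rw [hd2.deriv, ← hgt, mul_neg, ← mul_assoc, ← Real.rpow_add ht.1]
    simp
end

section
/- Let α ∈ (1,2]. Then there exists a continuous function x : [0,1] → ℝ with x(t) ≥ 0 for all t ∈ [0,1], x not identically zero, x twice differentiable on (0,1), satisfying t^(2-α)·x''(t) + t + e^{-x(t)} = 0 for all t ∈ (0,1), x(0) = 0, and x(1) = 2·∫₀^{1/3} x(t) dt. -/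
open Set MeasureTheory

/-- The solution `u` of `t ^ (2 - α) * u'' + φ = 0`, `u 0 = u 1 = 0`. -/
noncomputable def dirichletSol (α : ℝ) (φ : ℝ → ℝ) (t : ℝ) : ℝ :=
  (1 - t) * (∫ s in (0 : ℝ)..t, s * (s ^ (α - 2) * φ s)) +
    t * ∫ s in t..(1 : ℝ), (1 - s) * (s ^ (α - 2) * φ s)

/-- The solution `u` of `t ^ (2 - α) * u'' + φ = 0`, `u 0 = 0`, `u 1 = 2 * ∫ t in 0..1/3, u t`. -/
noncomputable def nonlocalSol (α : ℝ) (φ : ℝ → ℝ) (t : ℝ) : ℝ :=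
  dirichletSol α φ t + 9 / 4 * t * ∫ s in (0 : ℝ)..(1 / 3 : ℝ), dirichletSol α φ s

section

variable {α : ℝ} {φ ψ : ℝ → ℝ}

lemma intervalIntegrable_mul_rpow_mul (hα : 1 < α) (hφ : Continuous φ) {p : ℝ → ℝ}
    (hp : Continuous p) (a b : ℝ) :
    IntervalIntegrable (fun s => p s * (s ^ (α - 2) * φ s)) volume a b := by
  have h := intervalIntegral.intervalIntegrable_rpow' (a := a) (b := b)
    (show -1 < α - 2 by linarith)
  exact (h.mul_continuousOn hφ.continuousOn).continuousOn_mul hp.continuousOn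

lemma hasDerivAt_integral_mul_rpow_mul (hα : 1 < α) (hφ : Continuous φ) {p : ℝ → ℝ}
    (hp : Continuous p) (a : ℝ) {t : ℝ} (ht : 0 < t) :
    HasDerivAt (fun u => ∫ s in a..u, p s * (s ^ (α - 2) * φ s))
      (p t * (t ^ (α - 2) * φ t)) t := by
  have hc : ContinuousOn (fun s : ℝ => p s * (s ^ (α - 2) * φ s)) (Ioi 0) :=
    hp.continuousOn.mul ((continuousOn_id.rpow_const fun s hs => Or.inl (ne_of_gt hs)).mul
      hφ.continuousOn)
  exact intervalIntegral.integral_hasDerivAt_right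
    (intervalIntegrable_mul_rpow_mul hα hφ hp a t)
    (hc.stronglyMeasurableAtFilter isOpen_Ioi t ht)
    (hc.continuousAt (isOpen_Ioi.mem_nhds ht))

lemma continuous_dirichletSol (hα : 1 < α) (hφ : Continuous φ) :
    Continuous (dirichletSol α φ) := by
  have h1 := intervalIntegral.continuous_primitive
    (fun a b => intervalIntegrable_mul_rpow_mul hα hφ continuous_id a b) 0
  have h2 := intervalIntegral.continuous_primitive
    (fun a b => intervalIntegrable_mul_rpow_mul hα hφ (p := fun s => 1 - s) (by fun_prop) a b) 1
  simp only [id] at h1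
  refine (((continuous_const (y := (1 : ℝ))).sub continuous_id).mul h1).sub
    (continuous_id.mul h2) |>.congr fun u => ?_
  simp only [dirichletSol, id, Pi.sub_apply, Pi.mul_apply, intervalIntegral.integral_symm 1 u]
  ring

lemma hasDerivAt_dirichletSol (hα : 1 < α) (hφ : Continuous φ) {t : ℝ} (ht : 0 < t) :
    HasDerivAt (dirichletSol α φ)
      (-(∫ s in (0 : ℝ)..t, s * (s ^ (α - 2) * φ s)) -
        ∫ s in (1 : ℝ)..t, (1 - s) * (s ^ (α - 2) * φ s)) t := by
  have h1 := hasDerivAt_integral_mul_rpow_mul hα hφ continuous_id 0 ht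
  have h2 := hasDerivAt_integral_mul_rpow_mul hα hφ (p := fun s => 1 - s) (by fun_prop) 1 ht
  simp only [id] at h1
  have h := (((hasDerivAt_id' t).const_sub 1).mul h1).sub ((hasDerivAt_id' t).mul h2)
  refine (h.congr_of_eventuallyEq (Filter.Eventually.of_forall fun u => ?_)).congr_deriv ?_
  · simp only [dirichletSol, Pi.sub_apply, Pi.mul_apply, intervalIntegral.integral_symm 1 u]
    ring
  · ring

lemma dirichletSol_sub (hα : 1 < α) (hφ : Continuous φ) (hψ : Continuous ψ) (t : ℝ) :
    dirichletSol α φ t - dirichletSol α ψ t = dirichletSol α (fun s => φ s - ψ s) t := by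
  have key : ∀ p : ℝ → ℝ, Continuous p → ∀ a b : ℝ,
      ∫ s in a..b, p s * (s ^ (α - 2) * (φ s - ψ s)) =
        (∫ s in a..b, p s * (s ^ (α - 2) * φ s)) - ∫ s in a..b, p s * (s ^ (α - 2) * ψ s) := by
    intro p hp a b
    rw [← intervalIntegral.integral_sub (intervalIntegrable_mul_rpow_mul hα hφ hp a b)
      (intervalIntegrable_mul_rpow_mul hα hψ hp a b)]
    simp only [mul_sub]
  simp only [dirichletSol]
  rw [key (fun s => s) continuous_id, key (fun s => 1 - s) (by fun_prop)]
  ring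

lemma dirichletSol_nonneg (hφ : ∀ s ∈ Icc (0 : ℝ) 1, 0 ≤ φ s) {t : ℝ}
    (ht : t ∈ Icc (0 : ℝ) 1) : 0 ≤ dirichletSol α φ t := by
  obtain ⟨h0, h1⟩ := ht
  refine add_nonneg (mul_nonneg (by linarith) ?_) (mul_nonneg h0 ?_)
  · refine intervalIntegral.integral_nonneg h0 fun s hs => ?_
    have := hφ s ⟨hs.1, hs.2.trans h1⟩
    have := Real.rpow_nonneg hs.1 (α - 2)
    exact mul_nonneg hs.1 (by positivity)
  · refine intervalIntegral.integral_nonneg h1 fun s hs => ?_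
    have := hφ s ⟨h0.trans hs.1, hs.2⟩
    have := Real.rpow_nonneg (h0.trans hs.1) (α - 2)
    exact mul_nonneg (by linarith [hs.2]) (by positivity)

lemma mul_rpow_sub_two_le_one (hα : 1 < α) {s : ℝ} (hs : 0 < s) (hs1 : s ≤ 1) :
    s * s ^ (α - 2) ≤ 1 := by
  rw [mul_comm, ← Real.rpow_add_one hs.ne']
  exact Real.rpow_le_one hs.le hs1 (by linarith)

lemma abs_dirichletSol_le (hα : 1 < α) {M : ℝ}
    (hM : ∀ s ∈ Icc (0 : ℝ) 1, |φ s| ≤ M) {t : ℝ} (ht : t ∈ Icc (0 : ℝ) 1) :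
    |dirichletSol α φ t| ≤ M / 2 := by
  obtain ⟨h0, h1⟩ := ht
  have hM0 : 0 ≤ M := (abs_nonneg _).trans (hM 0 (by simp))
  have b1 : |∫ s in (0 : ℝ)..t, s * (s ^ (α - 2) * φ s)| ≤ t * M := by
    have := intervalIntegral.norm_integral_le_of_norm_le_const (a := 0) (b := t) (C := M)
      (f := fun s => s * (s ^ (α - 2) * φ s)) fun s hs => by
        rw [uIoc_of_le h0] at hs
        have h := mul_rpow_sub_two_le_one hα hs.1 (hs.2.trans h1)
        have hw := Real.rpow_nonneg hs.1.le (α - 2)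
        rw [Real.norm_eq_abs, ← mul_assoc, abs_mul, abs_of_nonneg (mul_nonneg hs.1.le hw)]
        have := mul_le_mul h (hM s ⟨hs.1.le, hs.2.trans h1⟩) (abs_nonneg _) zero_le_one
        linarith
    rw [Real.norm_eq_abs, sub_zero, abs_of_nonneg h0] at this
    linarith
  have b2 : |t * ∫ s in t..(1 : ℝ), (1 - s) * (s ^ (α - 2) * φ s)| ≤ (1 - t) ^ 2 / 2 * M := by
    rw [← intervalIntegral.integral_const_mul]
    have hi : ∫ s in t..(1 : ℝ), (1 - s) * M = (1 - t) ^ 2 / 2 * M := by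
      rw [intervalIntegral.integral_mul_const, intervalIntegral.integral_sub (by simp) (by simp)]
      simp only [intervalIntegral.integral_const, integral_id, smul_eq_mul]
      ring
    rw [← hi, ← Real.norm_eq_abs]
    refine intervalIntegral.norm_integral_le_of_norm_le h1 ?_
      (Continuous.intervalIntegrable (by fun_prop) _ _)
    refine Filter.Eventually.of_forall fun s hs => ?_
    have hs0 : 0 < s := h0.trans_lt hs.1
    have hw := Real.rpow_nonneg hs0.le (α - 2)
    have h : t * s ^ (α - 2) ≤ 1 :=
      (mul_le_mul_of_nonneg_right hs.1.le hw).trans (mul_rpow_sub_two_le_one hα hs0 hs.2)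
    have h' : 0 ≤ 1 - s := by linarith [hs.2]
    calc ‖t * ((1 - s) * (s ^ (α - 2) * φ s))‖ = (1 - s) * (t * s ^ (α - 2) * |φ s|) := by
          rw [Real.norm_eq_abs, abs_mul, abs_mul, abs_mul, abs_of_nonneg h0, abs_of_nonneg h',
            abs_of_nonneg hw]
          ring
      _ ≤ (1 - s) * (1 * M) := by
          gcongr
          exact hM s ⟨hs0.le, hs.2⟩
      _ = (1 - s) * M := by ring
  have h' : 0 ≤ 1 - t := by linarith
  have b1' : |(1 - t) * ∫ s in (0 : ℝ)..t, s * (s ^ (α - 2) * φ s)| ≤ (1 - t) * (t * M) := by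
    rw [abs_mul, abs_of_nonneg h']
    gcongr
  have := abs_add_le ((1 - t) * ∫ s in (0 : ℝ)..t, s * (s ^ (α - 2) * φ s))
    (t * ∫ s in t..(1 : ℝ), (1 - s) * (s ^ (α - 2) * φ s))
  unfold dirichletSol
  nlinarith [mul_nonneg (sq_nonneg t) hM0]

lemma continuous_nonlocalSol (hα : 1 < α) (hφ : Continuous φ) :
    Continuous (nonlocalSol α φ) := by
  have := continuous_dirichletSol hα hφ
  unfold nonlocalSol
  fun_prop

lemma hasDerivAt_nonlocalSol (hα : 1 < α) (hφ : Continuous φ) {t : ℝ} (ht : 0 < t) :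
    HasDerivAt (nonlocalSol α φ)
      (-(∫ s in (0 : ℝ)..t, s * (s ^ (α - 2) * φ s)) -
        (∫ s in (1 : ℝ)..t, (1 - s) * (s ^ (α - 2) * φ s)) +
        9 / 4 * ∫ s in (0 : ℝ)..(1 / 3 : ℝ), dirichletSol α φ s) t := by
  have h := (hasDerivAt_dirichletSol hα hφ ht).add
    (((hasDerivAt_id' t).const_mul (9 / 4)).mul_const
      (∫ s in (0 : ℝ)..(1 / 3 : ℝ), dirichletSol α φ s))
  exact h.congr_deriv (by ring)

lemma hasDerivAt_deriv_nonlocalSol (hα : 1 < α) (hφ : Continuous φ) {t : ℝ} (ht : 0 < t) :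
    HasDerivAt (deriv (nonlocalSol α φ)) (-(t ^ (α - 2) * φ t)) t := by
  have h1 := hasDerivAt_integral_mul_rpow_mul hα hφ continuous_id 0 ht
  have h2 := hasDerivAt_integral_mul_rpow_mul hα hφ (p := fun s => 1 - s) (by fun_prop) 1 ht
  have h := (h1.neg.sub h2).add_const
    (9 / 4 * ∫ s in (0 : ℝ)..(1 / 3 : ℝ), dirichletSol α φ s)
  refine (h.congr_of_eventuallyEq ?_).congr_deriv (by simp only [id]; ring)
  filter_upwards [Ioi_mem_nhds ht] with u hu
  rw [(hasDerivAt_nonlocalSol hα hφ hu).deriv]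
  simp

lemma nonlocalSol_nonneg (hφ : ∀ s ∈ Icc (0 : ℝ) 1, 0 ≤ φ s) {t : ℝ}
    (ht : t ∈ Icc (0 : ℝ) 1) : 0 ≤ nonlocalSol α φ t := by
  refine add_nonneg (dirichletSol_nonneg hφ ht) (mul_nonneg (by linarith [ht.1]) ?_)
  exact intervalIntegral.integral_nonneg (by norm_num) fun s hs =>
    dirichletSol_nonneg hφ ⟨hs.1, hs.2.trans (by norm_num)⟩

lemma nonlocalSol_sub (hα : 1 < α) (hφ : Continuous φ) (hψ : Continuous ψ) (t : ℝ) :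
    nonlocalSol α φ t - nonlocalSol α ψ t = nonlocalSol α (fun s => φ s - ψ s) t := by
  simp only [nonlocalSol, ← dirichletSol_sub hα hφ hψ]
  rw [intervalIntegral.integral_sub ((continuous_dirichletSol hα hφ).intervalIntegrable _ _)
    ((continuous_dirichletSol hα hψ).intervalIntegrable _ _)]
  ring

lemma abs_nonlocalSol_le (hα : 1 < α) {M : ℝ}
    (hM : ∀ s ∈ Icc (0 : ℝ) 1, |φ s| ≤ M) {t : ℝ} (ht : t ∈ Icc (0 : ℝ) 1) :
    |nonlocalSol α φ t| ≤ 7 / 8 * M := by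
  have hM0 : 0 ≤ M := (abs_nonneg _).trans (hM 0 (by simp))
  have h1 := abs_dirichletSol_le hα hM ht
  have h2 := intervalIntegral.norm_integral_le_of_norm_le_const (a := 0) (b := 1 / 3)
    (C := M / 2) (f := dirichletSol α φ) fun s hs => by
      rw [uIoc_of_le (by norm_num)] at hs
      exact abs_dirichletSol_le hα hM ⟨hs.1.le, hs.2.trans (by norm_num)⟩
  rw [Real.norm_eq_abs, sub_zero, abs_of_nonneg (by norm_num : (0 : ℝ) ≤ 1 / 3)] at h2
  have h3 : |9 / 4 * t * ∫ s in (0 : ℝ)..(1 / 3 : ℝ), dirichletSol α φ s| ≤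
      9 / 4 * 1 * (M / 2 * (1 / 3)) := by
    rw [abs_mul, abs_of_nonneg (by linarith [ht.1] : (0 : ℝ) ≤ 9 / 4 * t)]
    have := ht.2
    gcongr
  have := abs_add_le (dirichletSol α φ t)
    (9 / 4 * t * ∫ s in (0 : ℝ)..(1 / 3 : ℝ), dirichletSol α φ s)
  unfold nonlocalSol
  linarith

lemma nonlocalSol_zero : nonlocalSol α φ 0 = 0 := by
  simp [nonlocalSol, dirichletSol]

lemma nonlocalSol_one (hα : 1 < α) (hφ : Continuous φ) :
    nonlocalSol α φ 1 = 2 * ∫ t in (0 : ℝ)..(1 / 3 : ℝ), nonlocalSol α φ t := by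
  have h1 : dirichletSol α φ 1 = 0 := by simp [dirichletSol]
  simp only [nonlocalSol, h1]
  rw [intervalIntegral.integral_add ((continuous_dirichletSol hα hφ).intervalIntegrable _ _)
    (Continuous.intervalIntegrable (by fun_prop) _ _), intervalIntegral.integral_mul_const,
    intervalIntegral.integral_const_mul, integral_id]
  ring

end

lemma abs_exp_neg_abs_sub_le (a b : ℝ) :
    |Real.exp (-|a|) - Real.exp (-|b|)| ≤ |a - b| := by
  wlog h : |a| ≤ |b| generalizing a b
  · rw [abs_sub_comm, abs_sub_comm a]
    exact this b a (le_of_not_ge h)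
  have h1 : Real.exp (-|b|) = Real.exp (-|a|) * Real.exp (-(|b| - |a|)) := by
    rw [← Real.exp_add]
    ring_nf
  have h2 := Real.add_one_le_exp (-(|b| - |a|))
  have h3 : Real.exp (-|a|) ≤ 1 := Real.exp_le_one_iff.2 (by simp)
  have h4 := Real.exp_pos (-|a|)
  have h5 := abs_sub_abs_le_abs_sub b a
  rw [abs_of_nonneg (sub_nonneg.2 (Real.exp_le_exp.2 (by linarith))), h1, abs_sub_comm]
  nlinarith

theorem exists_eq_nonlocalSol {α : ℝ} (hα : 1 < α) :
    ∃ y : C(Icc (0 : ℝ) 1, ℝ), ∀ t : Icc (0 : ℝ) 1,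
      nonlocalSol α (fun s => s + Real.exp (-|y (projIcc 0 1 zero_le_one s)|)) t = y t := by
  have hc (y : C(Icc (0 : ℝ) 1, ℝ)) :
      Continuous fun s : ℝ => s + Real.exp (-|y (projIcc 0 1 zero_le_one s)|) := by
    have : Continuous (projIcc (0 : ℝ) 1 zero_le_one) := continuous_projIcc
    fun_prop
  let T (y : C(Icc (0 : ℝ) 1, ℝ)) : C(Icc (0 : ℝ) 1, ℝ) :=
    ⟨fun t => nonlocalSol α (fun s => s + Real.exp (-|y (projIcc 0 1 zero_le_one s)|)) t,
      (continuous_nonlocalSol hα (hc y)).comp continuous_subtype_val⟩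
  have hT : ContractingWith (7 / 8) T := by
    refine ⟨by rw [← NNReal.coe_lt_coe]; norm_num, LipschitzWith.of_dist_le_mul fun y z => ?_⟩
    refine (ContinuousMap.dist_le (by positivity)).2 fun t => ?_
    change |nonlocalSol α _ t - nonlocalSol α _ t| ≤ _
    rw [nonlocalSol_sub hα (hc y) (hc z)]
    refine (abs_nonlocalSol_le (M := dist y z) hα (fun s _ => ?_) t.2).trans_eq (by norm_num)
    rw [add_sub_add_left_eq_sub]
    exact (abs_exp_neg_abs_sub_le _ _).trans
      (ContinuousMap.dist_apply_le_dist (f := y) (g := z) (projIcc 0 1 zero_le_one s))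
  exact ⟨_, fun t => DFunLike.congr_fun hT.fixedPoint_isFixedPt t⟩

theorem stmt15 (α : ℝ) (hα : α ∈ Set.Ioc (1 : ℝ) 2) :
    ∃ x : ℝ → ℝ, ContinuousOn x (Set.Icc 0 1) ∧
      (∀ t ∈ Set.Icc (0 : ℝ) 1, 0 ≤ x t) ∧
      (∃ t ∈ Set.Icc (0 : ℝ) 1, x t ≠ 0) ∧
      (∀ t ∈ Set.Ioo (0 : ℝ) 1, DifferentiableAt ℝ x t ∧ DifferentiableAt ℝ (deriv x) t ∧
        t ^ (2 - α) * deriv (deriv x) t + (t + Real.exp (-(x t))) = 0) ∧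
      x 0 = 0 ∧ x 1 = 2 * ∫ t in (0 : ℝ)..(1 / 3 : ℝ), x t := by
  have hα1 := hα.1
  obtain ⟨y, hy⟩ := exists_eq_nonlocalSol hα1
  set φ : ℝ → ℝ := fun s => s + Real.exp (-|y (projIcc 0 1 zero_le_one s)|) with hφ_def
  have hφ : Continuous φ := by
    have : Continuous (projIcc (0 : ℝ) 1 zero_le_one) := continuous_projIcc
    fun_prop
  have hnn : ∀ t ∈ Icc (0 : ℝ) 1, 0 ≤ nonlocalSol α φ t := fun t ht =>
    nonlocalSol_nonneg (fun s hs => add_nonneg hs.1 (Real.exp_pos _).le) ht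
  have hφ_eq : ∀ t ∈ Icc (0 : ℝ) 1, φ t = t + Real.exp (-nonlocalSol α φ t) := by
    intro t ht
    have h := hnn t ht
    rw [hy ⟨t, ht⟩] at h ⊢
    simp only [hφ_def, projIcc_of_mem zero_le_one ht, abs_of_nonneg h]
  have hode : ∀ t ∈ Ioo (0 : ℝ) 1, t ^ (2 - α) * deriv (deriv (nonlocalSol α φ)) t +
      (t + Real.exp (-(nonlocalSol α φ t))) = 0 := by
    intro t ht
    rw [(hasDerivAt_deriv_nonlocalSol hα1 hφ ht.1).deriv, ← hφ_eq t (Ioo_subset_Icc_self ht),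
      mul_neg, ← mul_assoc, ← Real.rpow_add ht.1]
    simp
  refine ⟨nonlocalSol α φ, (continuous_nonlocalSol hα1 hφ).continuousOn, hnn, ?_,
    fun t ht => ⟨(hasDerivAt_nonlocalSol hα1 hφ ht.1).differentiableAt,
      (hasDerivAt_deriv_nonlocalSol hα1 hφ ht.1).differentiableAt, hode t ht⟩,
    nonlocalSol_zero, nonlocalSol_one hα1 hφ⟩
  by_contra! h
  have h0 : nonlocalSol α φ =ᶠ[nhds (1 / 2)] fun _ => 0 := by
    filter_upwards [Icc_mem_nhds (by norm_num : (0 : ℝ) < 1 / 2) (by norm_num : (1 / 2 : ℝ) < 1)] with t ht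
    exact h t ht
  have h2 := hode (1 / 2) (by norm_num)
  rw [h0.deriv.deriv_eq] at h2
  simp only [deriv_const', mul_zero, zero_add] at h2
  linarith [Real.exp_pos (-nonlocalSol α φ (1 / 2))]
end

section
/- There exists a continuous function x : [0,1] → ℝ with x(t) ≥ 0 for all t ∈ [0,1], x not identically zero, x twice differentiable on (0,1), satisfying t^{1/2}·x''(t) + t + ((4/5)·x(t)·e^{2x(t)})/(e^{2x(t)} + e^{x(t)} − 999/500) = 0 for all t ∈ (0,1), x(0) = 0, and x(1) = (8/5)·∫₀^{1/2} x(t) dt. -/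
open Set MeasureTheory

open Filter Topology

/-- The `k`-th moment `∫₀ᵗ uᵏ w(u) du` of a weight `w`. -/
noncomputable def moment (w : ℝ → ℝ) (k : ℕ) (t : ℝ) : ℝ := ∫ u in (0 : ℝ)..t, u ^ k * w u

/-- The initial slope for which `bvpSolution` satisfies the integral boundary condition. -/
noncomputable def bvpSlope (w : ℝ → ℝ) : ℝ :=
  5 / 4 * (moment w 0 1 - moment w 1 1) -
    (1 / 4 * moment w 0 (1 / 2) - moment w 1 (1 / 2) + moment w 2 (1 / 2))

/-- The solution of `x'' = -w`, `x 0 = 0`, `x 1 = (8/5) ∫₀^{1/2} x`. -/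
noncomputable def bvpSolution (w : ℝ → ℝ) (t : ℝ) : ℝ :=
  bvpSlope w * t - (t * moment w 0 t - moment w 1 t)

/-- The Green kernel of the boundary value problem solved by `bvpSolution`. -/
noncomputable def greenKernel (t u : ℝ) : ℝ :=
  t * (5 / 4 * (1 - u) - (max (1 / 2 - u) 0) ^ 2) - max (t - u) 0

lemma greenKernel_nonneg {t u : ℝ} (ht : t ∈ Icc (0 : ℝ) 1) (hu : u ∈ Icc (0 : ℝ) 1) :
    0 ≤ greenKernel t u := by
  obtain ⟨ht0, ht1⟩ := ht
  obtain ⟨hu0, hu1⟩ := hu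
  have hsq : (max (1 / 2 - u) 0) ^ 2 ≤ 1 / 4 * (1 - u) := by
    rcases max_cases (1 / 2 - u) 0 with ⟨h, h'⟩ | ⟨h, h'⟩ <;> rw [h] <;> nlinarith
  have hmax : max (t - u) 0 ≤ t * (1 - u) := max_le (by nlinarith) (by nlinarith)
  unfold greenKernel
  nlinarith [mul_le_mul_of_nonneg_left hsq ht0]

lemma greenKernel_le {t u : ℝ} (ht : t ∈ Icc (0 : ℝ) 1) (hu : u ∈ Icc (0 : ℝ) 1) :
    greenKernel t u ≤ 2 / 5 := by
  obtain ⟨ht0, ht1⟩ := ht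
  obtain ⟨hu0, hu1⟩ := hu
  have hsq : 0 ≤ t * (max (1 / 2 - u) 0) ^ 2 := by positivity
  have hmax : t * (1 - u) - u * (1 - u) ≤ max (t - u) 0 := by
    rcases le_total t u with h | h
    · exact le_max_of_le_right (by nlinarith)
    · exact le_max_of_le_left (by nlinarith)
  unfold greenKernel
  nlinarith [sq_nonneg (u - 3 / 8), mul_nonneg (sub_nonneg.2 ht1) (sub_nonneg.2 hu1)]

lemma continuous_greenKernel (t : ℝ) : Continuous (greenKernel t) := by
  unfold greenKernel
  fun_prop

section Linear

variable {w : ℝ → ℝ}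

lemma intervalIntegrable_pow_mul (hw : ∀ a b, IntervalIntegrable w volume a b) (k : ℕ) (a b : ℝ) :
    IntervalIntegrable (fun u => u ^ k * w u) volume a b :=
  (hw a b).continuousOn_mul (by fun_prop)

lemma continuous_moment (hw : ∀ a b, IntervalIntegrable w volume a b) (k : ℕ) :
    Continuous (moment w k) :=
  intervalIntegral.continuous_primitive (intervalIntegrable_pow_mul hw k) 0

lemma continuous_bvpSolution (hw : ∀ a b, IntervalIntegrable w volume a b) :
    Continuous (bvpSolution w) := by
  have h0 := continuous_moment hw 0
  have h1 := continuous_moment hw 1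
  unfold bvpSolution
  fun_prop

lemma hasDerivAt_moment (hw : ∀ a b, IntervalIntegrable w volume a b)
    (hc : ContinuousOn w (Ioi 0)) (k : ℕ) {t : ℝ} (ht : 0 < t) :
    HasDerivAt (moment w k) (t ^ k * w t) t := by
  have hcont : ContinuousOn (fun u => u ^ k * w u) (Ioi 0) := by fun_prop
  exact intervalIntegral.integral_hasDerivAt_right (intervalIntegrable_pow_mul hw k 0 t)
    (hcont.stronglyMeasurableAtFilter isOpen_Ioi t ht) (hcont.continuousAt (Ioi_mem_nhds ht))

lemma hasDerivAt_bvpSolution (hw : ∀ a b, IntervalIntegrable w volume a b)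
    (hc : ContinuousOn w (Ioi 0)) {t : ℝ} (ht : 0 < t) :
    HasDerivAt (bvpSolution w) (bvpSlope w - moment w 0 t) t := by
  refine (((hasDerivAt_id t).const_mul (bvpSlope w)).sub
    (((hasDerivAt_id t).mul (hasDerivAt_moment hw hc 0 ht)).sub
      (hasDerivAt_moment hw hc 1 ht))).congr_deriv ?_
  simp

lemma hasDerivAt_deriv_bvpSolution (hw : ∀ a b, IntervalIntegrable w volume a b)
    (hc : ContinuousOn w (Ioi 0)) {t : ℝ} (ht : 0 < t) :
    HasDerivAt (deriv (bvpSolution w)) (-w t) t := by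
  have heq : deriv (bvpSolution w) =ᶠ[𝓝 t] fun s => bvpSlope w - moment w 0 s := by
    filter_upwards [Ioi_mem_nhds ht] with s hs
    exact (hasDerivAt_bvpSolution hw hc hs).deriv
  refine HasDerivAt.congr_of_eventuallyEq ?_ heq
  simpa using (hasDerivAt_moment hw hc 0 ht).const_sub (bvpSlope w)

lemma moment_zero_right (k : ℕ) : moment w k 0 = 0 := by simp [moment]

lemma bvpSolution_zero : bvpSolution w 0 = 0 := by simp [bvpSolution, moment_zero_right]

lemma integral_bvpSolution (hw : ∀ a b, IntervalIntegrable w volume a b)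
    (hc : ContinuousOn w (Ioi 0)) {t : ℝ} (ht : 0 ≤ t) :
    ∫ s in (0 : ℝ)..t, bvpSolution w s = bvpSlope w * (t ^ 2 / 2) -
      (t ^ 2 / 2 * moment w 0 t - t * moment w 1 t + moment w 2 t / 2) := by
  have h0 := continuous_moment hw 0
  have h1 := continuous_moment hw 1
  have h2 := continuous_moment hw 2
  rw [intervalIntegral.integral_eq_sub_of_hasDerivAt_of_le (f := fun t => bvpSlope w * (t ^ 2 / 2) -
      (t ^ 2 / 2 * moment w 0 t - t * moment w 1 t + moment w 2 t / 2)) ht (by fun_prop) ?_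
      ((continuous_bvpSolution hw).intervalIntegrable _ _)]
  · simp [moment_zero_right]
  · intro s hs
    have hsq : HasDerivAt (fun s : ℝ => s ^ 2 / 2) s s := by
      simpa using (hasDerivAt_pow 2 s).div_const 2
    refine ((hsq.const_mul (bvpSlope w)).sub
      (((hsq.mul (hasDerivAt_moment hw hc 0 hs.1)).sub
        ((hasDerivAt_id s).mul (hasDerivAt_moment hw hc 1 hs.1))).add
          ((hasDerivAt_moment hw hc 2 hs.1).div_const 2))).congr_deriv ?_
    simp only [bvpSolution, id]
    ring

lemma bvpSolution_one (hw : ∀ a b, IntervalIntegrable w volume a b)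
    (hc : ContinuousOn w (Ioi 0)) :
    bvpSolution w 1 = 8 / 5 * ∫ t in (0 : ℝ)..(1 / 2 : ℝ), bvpSolution w t := by
  rw [integral_bvpSolution hw hc (by norm_num)]
  simp only [bvpSolution, bvpSlope]
  ring

lemma integral_truncated_pow_mul (hw : ∀ a b, IntervalIntegrable w volume a b) {t : ℝ}
    (ht : t ∈ Icc (0 : ℝ) 1) {n : ℕ} (hn : n ≠ 0) :
    ∫ u in (0 : ℝ)..1, (max (t - u) 0) ^ n * w u = ∫ u in (0 : ℝ)..t, (t - u) ^ n * w u := by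
  have hint : ∀ a b, IntervalIntegrable (fun u => (max (t - u) 0) ^ n * w u) volume a b :=
    fun a b => (hw a b).continuousOn_mul (by fun_prop)
  rw [← intervalIntegral.integral_add_adjacent_intervals (hint 0 t) (hint t 1)]
  have hright : ∫ u in t..1, (max (t - u) 0) ^ n * w u = 0 := by
    rw [intervalIntegral.integral_congr (g := fun _ => (0 : ℝ)), intervalIntegral.integral_zero]
    intro u hu
    rw [uIcc_of_le ht.2] at hu
    simp [max_eq_right (sub_nonpos.2 hu.1), hn]
  rw [hright, add_zero]
  refine intervalIntegral.integral_congr fun u hu => ?_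
  rw [uIcc_of_le ht.1] at hu
  simp [max_eq_left (sub_nonneg.2 hu.2)]

lemma bvpSolution_eq_integral (hw : ∀ a b, IntervalIntegrable w volume a b) {t : ℝ}
    (ht : t ∈ Icc (0 : ℝ) 1) :
    bvpSolution w t = ∫ u in (0 : ℝ)..1, greenKernel t u * w u := by
  have hp := intervalIntegrable_pow_mul hw
  have hlin : ∀ s, ∫ u in (0 : ℝ)..s, (s - u) ^ 1 * w u = s * moment w 0 s - moment w 1 s := by
    intro s
    simp only [moment]
    rw [← intervalIntegral.integral_const_mul,
      ← intervalIntegral.integral_sub ((hp 0 0 s).const_mul s) (hp 1 0 s)]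
    congr 1 with u
    ring
  have hquad : ∫ u in (0 : ℝ)..(1 / 2), (1 / 2 - u) ^ 2 * w u =
      1 / 4 * moment w 0 (1 / 2) - moment w 1 (1 / 2) + moment w 2 (1 / 2) := by
    simp only [moment]
    rw [← intervalIntegral.integral_const_mul,
      ← intervalIntegral.integral_sub ((hp 0 _ _).const_mul _) (hp 1 _ _),
      ← intervalIntegral.integral_add (((hp 0 _ _).const_mul _).sub (hp 1 _ _)) (hp 2 _ _)]
    congr 1 with u
    ring
  have htrunc : ∀ (s : ℝ) (n : ℕ),
      IntervalIntegrable (fun u => (max (s - u) 0) ^ n * w u) volume 0 1 :=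
    fun s n => (hw 0 1).continuousOn_mul (by fun_prop)
  have hone : IntervalIntegrable (fun u => (1 - u) ^ 1 * w u) volume 0 1 :=
    (hw 0 1).continuousOn_mul (by fun_prop)
  have hsplit : ∀ u, greenKernel t u * w u = t * (5 / 4 * ((1 - u) ^ 1 * w u) -
      (max (1 / 2 - u) 0) ^ 2 * w u) - (max (t - u) 0) ^ 1 * w u := by
    intro u
    simp only [greenKernel]
    ring
  simp only [hsplit]
  rw [intervalIntegral.integral_sub (((hone.const_mul _).sub (htrunc _ 2)).const_mul _)
      (htrunc t 1), intervalIntegral.integral_const_mul,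
    intervalIntegral.integral_sub (hone.const_mul _) (htrunc _ 2),
    intervalIntegral.integral_const_mul, integral_truncated_pow_mul hw ht one_ne_zero,
    integral_truncated_pow_mul hw (t := 1 / 2) (by norm_num) two_ne_zero, hlin, hlin, hquad]
  simp only [bvpSolution, bvpSlope]
  ring

end Linear

/-- The autonomous part of the nonlinearity. -/
noncomputable def nonlinearity (x : ℝ) : ℝ :=
  (4 / 5 * x * Real.exp (2 * x)) / (Real.exp (2 * x) + Real.exp x - 999 / 500)

lemma nonlinearity_denom_pos {x : ℝ} (hx : 0 ≤ x) :
    0 < Real.exp (2 * x) + Real.exp x - 999 / 500 := by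
  have h1 := Real.add_one_le_exp x
  have h2 := Real.add_one_le_exp (2 * x)
  linarith

lemma hasDerivAt_nonlinearity {x : ℝ} (hx : 0 ≤ x) :
    HasDerivAt nonlinearity
      (((4 / 5 * Real.exp (2 * x) + 4 / 5 * x * (Real.exp (2 * x) * 2)) *
        (Real.exp (2 * x) + Real.exp x - 999 / 500) -
        (4 / 5 * x * Real.exp (2 * x)) * (Real.exp (2 * x) * 2 + Real.exp x)) /
        (Real.exp (2 * x) + Real.exp x - 999 / 500) ^ 2) x := by
  have hexp : HasDerivAt (fun x : ℝ => Real.exp (2 * x)) (Real.exp (2 * x) * 2) x := by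
    simpa using ((hasDerivAt_id x).const_mul 2).exp
  have hlin : HasDerivAt (fun x : ℝ => 4 / 5 * x) (4 / 5) x := by
    simpa using (hasDerivAt_id x).const_mul (4 / 5 : ℝ)
  exact (hlin.mul hexp).div ((hexp.add (Real.hasDerivAt_exp x)).sub_const _)
    (nonlinearity_denom_pos hx).ne'

lemma continuousOn_nonlinearity : ContinuousOn nonlinearity (Ici 0) :=
  fun _ hx => (hasDerivAt_nonlinearity hx).continuousAt.continuousWithinAt

lemma monotoneOn_nonlinearity : MonotoneOn nonlinearity (Ici 0) := by
  refine monotoneOn_of_deriv_nonneg (convex_Ici 0) continuousOn_nonlinearity ?_ ?_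
  · intro x hx
    exact (hasDerivAt_nonlinearity (interior_subset hx)).differentiableAt.differentiableWithinAt
  · intro x hx
    have hx0 : 0 ≤ x := interior_subset hx
    rw [(hasDerivAt_nonlinearity hx0).deriv]
    refine div_nonneg ?_ (sq_nonneg _)
    have h1 : x + 1 ≤ Real.exp x := Real.add_one_le_exp x
    have h2 : 2 * x + 1 ≤ Real.exp (2 * x) := Real.add_one_le_exp (2 * x)
    have hkey : 0 ≤ Real.exp (2 * x) + Real.exp x - 999 / 500 +
        x * (Real.exp x - 2 * (999 / 500)) := by
      nlinarith
    have hfac := mul_nonneg (Real.exp_pos (2 * x)).le hkey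
    linarith

lemma nonlinearity_zero : nonlinearity 0 = 0 := by simp [nonlinearity]

lemma nonlinearity_nonneg {x : ℝ} (hx : 0 ≤ x) : 0 ≤ nonlinearity x :=
  nonlinearity_zero ▸ monotoneOn_nonlinearity self_mem_Ici hx hx

lemma nonlinearity_three_le : nonlinearity 3 ≤ 12 / 5 := by
  unfold nonlinearity
  rw [div_le_iff₀ (nonlinearity_denom_pos (by norm_num))]
  linarith [Real.add_one_le_exp (3 : ℝ)]

/-- Truncation of a real number to `[a, b]`. -/
noncomputable def clamp (a b x : ℝ) : ℝ := max a (min b x)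

lemma clamp_mem {a b : ℝ} (h : a ≤ b) (x : ℝ) : clamp a b x ∈ Icc a b :=
  ⟨le_max_left _ _, max_le h (min_le_left _ _)⟩

lemma clamp_of_mem {a b x : ℝ} (hx : x ∈ Icc a b) : clamp a b x = x := by
  rw [clamp, min_eq_right hx.2, max_eq_right hx.1]

lemma monotone_clamp (a b : ℝ) : Monotone (clamp a b) :=
  fun _ _ h => max_le_max le_rfl (min_le_min le_rfl h)

lemma continuous_clamp (a b : ℝ) : Continuous (clamp a b) := by
  unfold clamp
  fun_prop

lemma continuous_nonlinearity_clamp : Continuous fun x => nonlinearity (clamp 0 3 x) :=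
  continuousOn_nonlinearity.comp_continuous (continuous_clamp 0 3)
    fun x => (clamp_mem (by norm_num) x).1

lemma monotone_nonlinearity_clamp : Monotone fun x => nonlinearity (clamp 0 3 x) :=
  fun x y h => monotoneOn_nonlinearity (clamp_mem (by norm_num) x).1
    (clamp_mem (by norm_num) y).1 (monotone_clamp 0 3 h)

lemma nonlinearity_clamp_mem (x : ℝ) : nonlinearity (clamp 0 3 x) ∈ Icc (0 : ℝ) (12 / 5) := by
  have h := clamp_mem (show (0 : ℝ) ≤ 3 by norm_num) x
  exact ⟨nonlinearity_nonneg h.1, (monotoneOn_nonlinearity h.1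
    (show (3 : ℝ) ∈ Ici 0 by norm_num [mem_Ici]) h.2).trans nonlinearity_three_le⟩

/-- The singular weight `u^{-1/2} q(u)`. -/
noncomputable def singularWeight (q : ℝ → ℝ) (u : ℝ) : ℝ := u ^ (-(1 / 2) : ℝ) * q u

/-- The class of sources in which the fixed point is sought. -/
structure IsSource (q : ℝ → ℝ) : Prop where
  measurable : Measurable q
  mem_Icc : ∀ u, q u ∈ Icc (0 : ℝ) (7 / 2)

lemma intervalIntegrable_singular (a b : ℝ) :
    IntervalIntegrable (fun u : ℝ => u ^ (-(1 / 2) : ℝ)) volume a b :=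
  intervalIntegral.intervalIntegrable_rpow' (by norm_num)

lemma measurable_singular : Measurable fun u : ℝ => u ^ (-(1 / 2) : ℝ) := by fun_prop

lemma IsSource.intervalIntegrable {q : ℝ → ℝ} (hq : IsSource q) (a b : ℝ) :
    IntervalIntegrable (singularWeight q) volume a b := by
  refine ((intervalIntegrable_singular a b).norm.mul_const (7 / 2)).mono_fun
    (measurable_singular.mul hq.measurable).aestronglyMeasurable (Eventually.of_forall fun u => ?_)
  obtain ⟨h0, h1⟩ := hq.mem_Icc u
  simp only [singularWeight, norm_mul, norm_norm]
  gcongr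
  rw [Real.norm_of_nonneg h0]
  norm_num [h1]

lemma integral_singular : ∫ u in (0 : ℝ)..1, u ^ (-(1 / 2) : ℝ) = 2 := by
  rw [integral_rpow (Or.inl (by norm_num))]
  norm_num

lemma bvpSolution_mono {p q : ℝ → ℝ} (hp : IsSource p) (hq : IsSource q) (hpq : ∀ u, p u ≤ q u)
    {t : ℝ} (ht : t ∈ Icc (0 : ℝ) 1) :
    bvpSolution (singularWeight p) t ≤ bvpSolution (singularWeight q) t := by
  rw [bvpSolution_eq_integral hp.intervalIntegrable ht,
    bvpSolution_eq_integral hq.intervalIntegrable ht]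
  refine intervalIntegral.integral_mono_on zero_le_one
    ((hp.intervalIntegrable 0 1).continuousOn_mul (continuous_greenKernel t).continuousOn)
    ((hq.intervalIntegrable 0 1).continuousOn_mul (continuous_greenKernel t).continuousOn)
    fun u hu => ?_
  exact mul_le_mul_of_nonneg_left (mul_le_mul_of_nonneg_left (hpq u)
    (Real.rpow_nonneg hu.1 _)) (greenKernel_nonneg ht hu)

lemma bvpSolution_mem {q : ℝ → ℝ} (hq : IsSource q) {t : ℝ} (ht : t ∈ Icc (0 : ℝ) 1) :
    bvpSolution (singularWeight q) t ∈ Icc (0 : ℝ) 3 := by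
  rw [bvpSolution_eq_integral hq.intervalIntegrable ht]
  constructor
  · refine intervalIntegral.integral_nonneg zero_le_one fun u hu => ?_
    exact mul_nonneg (greenKernel_nonneg ht hu)
      (mul_nonneg (Real.rpow_nonneg hu.1 _) (hq.mem_Icc u).1)
  · calc ∫ u in (0 : ℝ)..1, greenKernel t u * singularWeight q u
        ≤ ∫ u in (0 : ℝ)..1, 2 / 5 * (u ^ (-(1 / 2) : ℝ) * (7 / 2)) := by
          refine intervalIntegral.integral_mono_on zero_le_one
            ((hq.intervalIntegrable 0 1).continuousOn_mul (continuous_greenKernel t).continuousOn)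
            (((intervalIntegrable_singular 0 1).mul_const _).const_mul _) fun u hu => ?_
          have hu0 := Real.rpow_nonneg hu.1 (-(1 / 2))
          exact mul_le_mul (greenKernel_le ht hu)
            (mul_le_mul_of_nonneg_left (hq.mem_Icc u).2 hu0)
            (mul_nonneg hu0 (hq.mem_Icc u).1) (by norm_num)
      _ = 14 / 5 := by
          rw [intervalIntegral.integral_const_mul, intervalIntegral.integral_mul_const,
            integral_singular]
          norm_num
      _ ≤ 3 := by norm_num

lemma tendsto_bvpSolution {q : ℕ → ℝ → ℝ} {p : ℝ → ℝ} (hq : ∀ n, IsSource (q n))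
    (hp : IsSource p) (hlim : ∀ u, Tendsto (fun n => q n u) atTop (𝓝 (p u)))
    {t : ℝ} (ht : t ∈ Icc (0 : ℝ) 1) :
    Tendsto (fun n => bvpSolution (singularWeight (q n)) t) atTop
      (𝓝 (bvpSolution (singularWeight p) t)) := by
  simp only [fun n => bvpSolution_eq_integral (hq n).intervalIntegrable ht,
    bvpSolution_eq_integral hp.intervalIntegrable ht]
  refine intervalIntegral.tendsto_integral_filter_of_dominated_convergence
    (fun u => 2 / 5 * (u ^ (-(1 / 2) : ℝ) * (7 / 2))) (Eventually.of_forall fun n => ?_)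
    (Eventually.of_forall fun n => Eventually.of_forall fun u hu => ?_)
    (((intervalIntegrable_singular 0 1).mul_const _).const_mul _)
    (Eventually.of_forall fun u _ => ((hlim u).const_mul _).const_mul _)
  · exact ((continuous_greenKernel t).measurable.mul
      (measurable_singular.mul (hq n).measurable)).aestronglyMeasurable
  · rw [uIoc_of_le zero_le_one] at hu
    have hu' := Ioc_subset_Icc_self hu
    have hu0 := Real.rpow_nonneg hu'.1 (-(1 / 2))
    have hK := greenKernel_nonneg ht hu'
    have hw := mul_nonneg hu0 ((hq n).mem_Icc u).1
    rw [singularWeight, Real.norm_of_nonneg (mul_nonneg hK hw)]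
    exact mul_le_mul (greenKernel_le ht hu') (mul_le_mul_of_nonneg_left ((hq n).mem_Icc u).2 hu0)
      hw (by norm_num)

/-- The source produced by the solution of the linear problem with source `q`. -/
noncomputable def sourceMap (q : ℝ → ℝ) (u : ℝ) : ℝ :=
  clamp 0 1 u + nonlinearity (clamp 0 3 (bvpSolution (singularWeight q) (clamp 0 1 u)))

lemma IsSource.continuous_sourceMap {q : ℝ → ℝ} (hq : IsSource q) : Continuous (sourceMap q) :=
  (continuous_clamp 0 1).add (continuous_nonlinearity_clamp.comp
    ((continuous_bvpSolution hq.intervalIntegrable).comp (continuous_clamp 0 1)))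

lemma IsSource.sourceMap {q : ℝ → ℝ} (hq : IsSource q) : IsSource (sourceMap q) := by
  refine ⟨hq.continuous_sourceMap.measurable, fun u => ?_⟩
  have h1 := clamp_mem (zero_le_one (α := ℝ)) u
  have h2 := nonlinearity_clamp_mem (bvpSolution (singularWeight q) (clamp 0 1 u))
  exact ⟨add_nonneg h1.1 h2.1, (add_le_add h1.2 h2.2).trans (by norm_num)⟩

lemma sourceMap_mono {p q : ℝ → ℝ} (hp : IsSource p) (hq : IsSource q) (hpq : ∀ u, p u ≤ q u)
    (u : ℝ) : sourceMap p u ≤ sourceMap q u :=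
  add_le_add le_rfl (monotone_nonlinearity_clamp
    (bvpSolution_mono hp hq hpq (clamp_mem zero_le_one u)))

lemma exists_isSource_sourceMap_eq : ∃ q, IsSource q ∧ sourceMap q = q := by
  set q : ℕ → ℝ → ℝ := fun n => sourceMap^[n] fun _ => 0
  have hsucc : ∀ n, q (n + 1) = sourceMap (q n) := fun n => Function.iterate_succ_apply' _ _ _
  have hq : ∀ n, IsSource (q n) := by
    intro n
    induction n with
    | zero => exact ⟨measurable_const, fun u => by norm_num [q]⟩
    | succ n ih => exact hsucc n ▸ ih.sourceMap
  have hstep : ∀ n u, q n u ≤ q (n + 1) u := by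
    intro n
    induction n with
    | zero => exact fun u => ((hq 1).mem_Icc u).1
    | succ n ih =>
      intro u
      rw [hsucc n, hsucc (n + 1)]
      exact sourceMap_mono (hq n) (hq (n + 1)) ih u
  have hlim : ∀ u, ∃ l, Tendsto (fun n => q n u) atTop (𝓝 l) := fun u =>
    ⟨_, tendsto_atTop_ciSup (monotone_nat_of_le_succ fun n => hstep n u)
      ⟨7 / 2, by rintro _ ⟨n, rfl⟩; exact ((hq n).mem_Icc u).2⟩⟩
  choose p hp using hlim
  have hsrc : IsSource p :=
    ⟨measurable_of_tendsto_metrizable (fun n => (hq n).measurable) (tendsto_pi_nhds.2 hp),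
      fun u => isClosed_Icc.mem_of_tendsto (hp u) (Eventually.of_forall fun n => (hq n).mem_Icc u)⟩
  refine ⟨p, hsrc, funext fun u => ?_⟩
  have hmap : Tendsto (fun n => sourceMap (q n) u) atTop (𝓝 (sourceMap p u)) :=
    ((continuous_nonlinearity_clamp.tendsto _).comp
      (tendsto_bvpSolution hq hsrc hp (clamp_mem zero_le_one u))).const_add _
  refine tendsto_nhds_unique hmap ?_
  simpa only [← hsucc] using (tendsto_add_atTop_iff_nat 1).2 (hp u)

theorem stmt16 :
    ∃ x : ℝ → ℝ, ContinuousOn x (Set.Icc 0 1) ∧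
      (∀ t ∈ Set.Icc (0 : ℝ) 1, 0 ≤ x t) ∧
      (∃ t ∈ Set.Icc (0 : ℝ) 1, x t ≠ 0) ∧
      (∀ t ∈ Set.Ioo (0 : ℝ) 1, DifferentiableAt ℝ x t ∧ DifferentiableAt ℝ (deriv x) t ∧
        t ^ ((1 : ℝ) / 2) * deriv (deriv x) t +
          (t + (4 / 5 * x t * Real.exp (2 * x t)) /
            (Real.exp (2 * x t) + Real.exp (x t) - 999 / 500)) = 0) ∧
      x 0 = 0 ∧ x 1 = 8 / 5 * ∫ t in (0 : ℝ)..(1 / 2 : ℝ), x t := by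
  obtain ⟨q, hq, hfix⟩ := exists_isSource_sourceMap_eq
  have hw := hq.intervalIntegrable
  have hqc : Continuous q := hfix ▸ hq.continuous_sourceMap
  have hc : ContinuousOn (singularWeight q) (Ioi 0) :=
    (continuousOn_id.rpow_const fun u hu => Or.inl (ne_of_gt hu)).mul hqc.continuousOn
  set x := bvpSolution (singularWeight q)
  have hode : ∀ t ∈ Ioo (0 : ℝ) 1,
      t ^ ((1 : ℝ) / 2) * deriv (deriv x) t + (t + nonlinearity (x t)) = 0 := by
    intro t ht
    have ht' := Ioo_subset_Icc_self ht
    have hqt : q t = t + nonlinearity (x t) := by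
      rw [← congrFun hfix t, sourceMap, clamp_of_mem ht', clamp_of_mem (bvpSolution_mem hq ht')]
    rw [(hasDerivAt_deriv_bvpSolution hw hc ht.1).deriv, ← hqt, singularWeight, mul_neg,
      ← mul_assoc, ← Real.rpow_add ht.1]
    norm_num
  refine ⟨x, (continuous_bvpSolution hw).continuousOn, fun t ht => (bvpSolution_mem hq ht).1, ?_,
    fun t ht => ⟨(hasDerivAt_bvpSolution hw hc ht.1).differentiableAt,
      (hasDerivAt_deriv_bvpSolution hw hc ht.1).differentiableAt, hode t ht⟩,
    bvpSolution_zero, bvpSolution_one hw hc⟩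
  by_contra! hzero
  have hmem : (1 / 2 : ℝ) ∈ Ioo (0 : ℝ) 1 := by norm_num
  have heq : x =ᶠ[𝓝 (1 / 2)] fun _ => 0 := by
    filter_upwards [Ioo_mem_nhds hmem.1 hmem.2] with t ht
    exact hzero t (Ioo_subset_Icc_self ht)
  have hhalf := hode _ hmem
  rw [heq.deriv.deriv_eq, hzero _ (Ioo_subset_Icc_self hmem), nonlinearity_zero] at hhalf
  norm_num at hhalf
end
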